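/- Let n ≥ 1, 0 < α < 2n, and 1 < p₁, p₂, q < ∞ with α/n < 1/p₁ + 1/p₂ and 1/q = 1/p₁ + 1/p₂ − α/n. There exist constants γ₂ > γ₁ > 2, γ₃ > 0, and 0 < β < γ₂ depending only on n, α, p₁, p₂, q, ε with the following property. Suppose b ∈ BMO(ℝⁿ) with ‖b‖_* = 1, 0 < ε < 1, and Q is a cube with center x_Q and side length r_Q on which b is not constant and |Q|⁻¹ ∫_Q |b(y) − b_Q| dy > ε^{1/2}. For i = 1, 2 set f_i(y) = |Q|^{−1/p_i}(sgn(b(y) − b_Q) − c₀) χ_Q(y), where c₀ = |Q|⁻¹ ∫_Q sgn(b(y) − b_Q) dy. Then with b⃗ = (b,b): (i) ∫_{γ₁ r_Q < |x − x_Q| < γ₂ r_Q} |[Πb⃗,I_α](f₁,f₂)(x)|^q dx ≥ γ₃^q; (ii) ∫_{|x − x_Q| > γ₂ r_Q} |[Πb⃗,I_α](f₁,f₂)(x)|^q dx ≤ γ₃^q/4^q; (iii) for every measurable set E ⊆ {x : γ₁ r_Q < |x − x_Q| < γ₂ r_Q} with |E|/|Q| < βⁿ, one has ∫_E |[Πb⃗,I_α](f₁,f₂)(x)|^q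 dx ≤ γ₃^q/4^q. -/

import Mathlib

open MeasureTheory Filter
open scoped ENNReal Topology

noncomputable section

/-- Euclidean space `ℝⁿ`. -/
abbrev Rn (n : ℕ) := EuclideanSpace ℝ (Fin n)

/-- Axis-parallel closed cube with center `c` and side length `r`. -/
def cube (n : ℕ) (c : Rn n) (r : ℝ) : Set (Rn n) := {y | ∀ i, |y i - c i| ≤ r / 2}

/-- Average of `b` over a set `Q`. -/
def avg (n : ℕ) (b : Rn n → ℝ) (Q : Set (Rn n)) : ℝ :=
  (volume Q).toReal⁻¹ * ∫ x in Q, b x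

/-- Mean oscillation of `b` over a set `Q`. -/
def osc (n : ℕ) (b : Rn n → ℝ) (Q : Set (Rn n)) : ℝ :=
  (volume Q).toReal⁻¹ * ∫ x in Q, |b x - avg n b Q|

/-- The BMO seminorm `‖b‖_*`, as an extended real number (supremum of the mean
oscillations over all cubes). -/
def bmoNorm (n : ℕ) (b : Rn n → ℝ) : ℝ≥0∞ :=
  ⨆ (c : Rn n) (r : {r : ℝ // 0 < r}), ENNReal.ofReal (osc n b (cube n c r.1))

/-- `b ∈ BMO(ℝⁿ)`. -/
def MemBMO (n : ℕ) (b : Rn n → ℝ) : Prop :=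
  LocallyIntegrable b volume ∧ bmoNorm n b < ⊤

/-- `b ∈ CMO(ℝⁿ)`: `b` lies in the closure of `C_c^∞(ℝⁿ)` in the BMO seminorm. -/
def MemCMO (n : ℕ) (b : Rn n → ℝ) : Prop :=
  LocallyIntegrable b volume ∧
  ∀ ε : ℝ, 0 < ε → ∃ g : Rn n → ℝ, ContDiff ℝ (⊤ : ℕ∞) g ∧ HasCompactSupport g ∧
    bmoNorm n (fun x => b x - g x) ≤ ENNReal.ofReal ε

/-- The bilinear fractional integral operator `B_α`. -/
def Bop (n : ℕ) (α : ℝ) (f g : Rn n → ℝ) (x : Rn n) : ℝ :=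
  ∫ y, f (x - y) * g (x + y) * ‖y‖ ^ (α - n)

/-- The first commutator `[b, B_α]₁`. -/
def commB (n : ℕ) (α : ℝ) (b f g : Rn n → ℝ) (x : Rn n) : ℝ :=
  ∫ y, (b x - b y) * f y * g ((2 : ℝ) • x - y) * ‖x - y‖ ^ (α - n)

/-- The bilinear fractional integral operator `I_α`. -/
def Iop (n : ℕ) (α : ℝ) (f₁ f₂ : Rn n → ℝ) (x : Rn n) : ℝ :=
  ∫ y₁, ∫ y₂, f₁ y₁ * f₂ y₂ * (‖x - y₁‖ ^ 2 + ‖x - y₂‖ ^ 2) ^ (α / 2 - n)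

/-- The iterated commutator `[Πb⃗, I_α]` with `b⃗ = (b, b)`. -/
def commI (n : ℕ) (α : ℝ) (b f₁ f₂ : Rn n → ℝ) (x : Rn n) : ℝ :=
  ∫ y₁, ∫ y₂, (b x - b y₁) * (b x - b y₂) * f₁ y₁ * f₂ y₂ *
    (‖x - y₁‖ ^ 2 + ‖x - y₂‖ ^ 2) ^ (α / 2 - n)

/-- The Muckenhoupt class `A_p`. -/
def MemAp (n : ℕ) (p : ℝ) (w : Rn n → ℝ) : Prop :=
  ∃ C : ℝ, ∀ (c : Rn n) (r : ℝ), 0 < r →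
    ((volume (cube n c r)).toReal⁻¹ * ∫ x in cube n c r, w x) *
      ((volume (cube n c r)).toReal⁻¹ * ∫ x in cube n c r, w x ^ (-(1 / (p - 1)))) ^ (p - 1) ≤ C

/-- The bilinear weight class `A_{P,q}` with `P = (p₁, p₂)`. -/
def MemAPq (n : ℕ) (p₁ p₂ q : ℝ) (w₁ w₂ : Rn n → ℝ) : Prop :=
  ∃ C : ℝ, ∀ (c : Rn n) (r : ℝ), 0 < r →
    ((volume (cube n c r)).toReal⁻¹ * ∫ x in cube n c r, w₁ x ^ q * w₂ x ^ q) *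
      ((volume (cube n c r)).toReal⁻¹ *
          ∫ x in cube n c r, w₁ x ^ (-(1 - 1 / p₁)⁻¹)) ^ (q * (1 - 1 / p₁)) *
      ((volume (cube n c r)).toReal⁻¹ *
          ∫ x in cube n c r, w₂ x ^ (-(1 - 1 / p₂)⁻¹)) ^ (q * (1 - 1 / p₂)) ≤ C

section BallOscillation

variable {E : Type*} [NormedAddCommGroup E] [NormedSpace ℝ E] [FiniteDimensional ℝ E]
  [MeasurableSpace E] [BorelSpace E]

/-- Average of `b` over the closed ball `B(x, ρ)`. -/
def ballAvg (μ : Measure E) (b : E → ℝ) (x : E) (ρ : ℝ) : ℝ :=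
  ⨍ y in Metric.closedBall x ρ, b y ∂μ

/-- All mean oscillations of `b` over closed balls are at most `K`. -/
def BallOscLE (μ : Measure E) (b : E → ℝ) (K : ℝ) : Prop :=
  ∀ x ρ, 0 < ρ → ∫ y in Metric.closedBall x ρ, |b y - ballAvg μ b x ρ| ∂μ ≤
    K * μ.real (Metric.closedBall x ρ)

theorem abs_setAverage_sub_le {X : Type*} [MeasurableSpace X] {μ : Measure X} {S : Set X}
    {b : X → ℝ} (hb : IntegrableOn b S μ) (hS : 0 < μ.real S) (a : ℝ) :
    |(⨍ y in S, b y ∂μ) - a| ≤ (∫ y in S, |b y - a| ∂μ) / μ.real S := by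
  have hfin : μ S ≠ ∞ := by
    intro h
    simp [measureReal_def, h] at hS
  have h1 : (⨍ y in S, b y ∂μ) - a = (∫ y in S, (b y - a) ∂μ) / μ.real S := by
    rw [integral_sub hb (integrableOn_const hfin), setIntegral_const, setAverage_eq,
      smul_eq_mul, smul_eq_mul]
    field_simp
  rw [h1, abs_div, abs_of_pos hS]
  gcongr
  exact abs_integral_le_integral_abs

theorem locallyIntegrable_abs_sub_const {X : Type*} [TopologicalSpace X] [MeasurableSpace X]
    {μ : Measure X} [IsLocallyFiniteMeasure μ] {b : X → ℝ} (hb : LocallyIntegrable b μ) (a : ℝ) :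
    LocallyIntegrable (fun y => |b y - a|) μ := fun x =>
  let ⟨s, hs, hi⟩ := (hb.sub (locallyIntegrable_const a)) x
  ⟨s, hs, hi.norm⟩

/-- Stopping radius: at a Lebesgue point where `h` exceeds `L`, there is a ball on which the
average of `h` is larger than `L`, while it is at most `L` on the ball enlarged five times. -/
theorem exists_stopping_radius {X : Type*} [PseudoMetricSpace X] [MeasurableSpace X]
    {μ : Measure X} {h : X → ℝ} {x : X} {R L : ℝ} (hR : 0 < R)
    (hx : Tendsto (fun t => ⨍ y in Metric.closedBall x t, h y ∂μ) (𝓝[>] 0) (𝓝 (h x)))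
    (hL : L < h x) (hRL : ⨍ y in Metric.closedBall x R, h y ∂μ ≤ L) :
    ∃ t, 0 < t ∧ 5 * t ≤ R ∧ L < ⨍ y in Metric.closedBall x t, h y ∂μ ∧
      ⨍ y in Metric.closedBall x (5 * t), h y ∂μ ≤ L := by
  classical
  have hlim : Tendsto (fun k : ℕ => R * (1 / 5 : ℝ) ^ k) atTop (𝓝[>] 0) := by
    refine tendsto_nhdsWithin_iff.2 ⟨?_, Eventually.of_forall fun k => ?_⟩
    · simpa using (tendsto_pow_atTop_nhds_zero_of_lt_one (r := (1 / 5 : ℝ)) (by norm_num)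
        (by norm_num)).const_mul R
    · simp only [Set.mem_Ioi]; positivity
  have hex : ∃ k : ℕ, L < ⨍ y in Metric.closedBall x (R * (1 / 5 : ℝ) ^ k), h y ∂μ :=
    ((hx.comp hlim).eventually (lt_mem_nhds hL)).exists
  have hspec := Nat.find_spec hex
  rcases hk : Nat.find hex with _ | k
  · rw [hk] at hspec
    simp only [pow_zero, mul_one] at hspec
    exact absurd hRL hspec.not_ge
  · rw [hk] at hspec
    have hmin := Nat.find_min hex (m := k) (by omega)
    have h5 : 5 * (R * (1 / 5 : ℝ) ^ (k + 1)) = R * (1 / 5 : ℝ) ^ k := by rw [pow_succ]; ring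
    refine ⟨R * (1 / 5 : ℝ) ^ (k + 1), by positivity, ?_, hspec, ?_⟩
    · rw [h5]
      exact mul_le_of_le_one_right hR.le (pow_le_one₀ (by norm_num) (by norm_num))
    · rw [h5]
      exact not_lt.1 hmin

theorem measureReal_closedBall_pos {X : Type*} [PseudoMetricSpace X] [ProperSpace X]
    [MeasurableSpace X] (μ : Measure X) [IsLocallyFiniteMeasure μ] [μ.IsOpenPosMeasure] (x : X) {r : ℝ} (hr : 0 < r) :
    0 < μ.real (Metric.closedBall x r) :=
  ENNReal.toReal_pos (Metric.measure_closedBall_pos μ x hr).ne' measure_closedBall_lt_top.ne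

variable (μ : Measure E) [μ.IsAddHaarMeasure]

theorem measureReal_closedBall_mul (x : E) {t r : ℝ} (ht : 0 ≤ t) (hr : 0 ≤ r) :
    μ.real (Metric.closedBall x (t * r)) =
      t ^ Module.finrank ℝ E * μ.real (Metric.closedBall x r) := by
  rw [measureReal_def, measureReal_def, Measure.addHaar_closedBall_mul μ x ht hr,
    ENNReal.toReal_mul, ENNReal.toReal_ofReal (by positivity),
    Measure.addHaar_closedBall_center μ x]

variable {μ}

theorem abs_ballAvg_two_mul_sub_le {b : E → ℝ} (hb : LocallyIntegrable b μ) {K : ℝ}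
    (hK : BallOscLE μ b K) (x : E) {ρ : ℝ} (hρ : 0 < ρ) :
    |ballAvg μ b x (2 * ρ) - ballAvg μ b x ρ| ≤ 2 ^ Module.finrank ℝ E * K := by
  have hpos := measureReal_closedBall_pos μ x hρ
  rw [abs_sub_comm]
  refine (abs_setAverage_sub_le
    (hb.integrableOn_isCompact (isCompact_closedBall x ρ)) hpos _).trans ?_
  rw [div_le_iff₀ hpos]
  calc ∫ y in Metric.closedBall x ρ, |b y - ballAvg μ b x (2 * ρ)| ∂μ
      ≤ ∫ y in Metric.closedBall x (2 * ρ), |b y - ballAvg μ b x (2 * ρ)| ∂μ := by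
        refine setIntegral_mono_set ?_ (ae_of_all _ fun y => abs_nonneg _)
          (Metric.closedBall_subset_closedBall (by linarith)).eventuallyLE
        exact (locallyIntegrable_abs_sub_const hb _).integrableOn_isCompact
          (isCompact_closedBall x _)
    _ ≤ K * μ.real (Metric.closedBall x (2 * ρ)) := hK x _ (by linarith)
    _ = _ := by rw [measureReal_closedBall_mul μ x (by norm_num) hρ.le]; ring

theorem setIntegral_closedBall_two_mul_le {b : E → ℝ} (hb : LocallyIntegrable b μ) {K : ℝ}
    (hK : BallOscLE μ b K) (x : E) {ρ : ℝ} (hρ : 0 < ρ) :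
    ∫ y in Metric.closedBall x (2 * ρ), |b y - ballAvg μ b x ρ| ∂μ ≤
      2 ^ Module.finrank ℝ E * (1 + 2 ^ Module.finrank ℝ E) * K *
        μ.real (Metric.closedBall x ρ) := by
  have hint : ∀ a, IntegrableOn (fun y => |b y - a|) (Metric.closedBall x (2 * ρ)) μ := fun a =>
    (locallyIntegrable_abs_sub_const hb _).integrableOn_isCompact (isCompact_closedBall x _)
  have hconst : IntegrableOn (fun _ : E => |ballAvg μ b x (2 * ρ) - ballAvg μ b x ρ|)
      (Metric.closedBall x (2 * ρ)) μ := integrableOn_const measure_closedBall_lt_top.ne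
  have h2 := measureReal_closedBall_mul μ x (zero_le_two (α := ℝ)) hρ.le
  calc ∫ y in Metric.closedBall x (2 * ρ), |b y - ballAvg μ b x ρ| ∂μ
      ≤ ∫ y in Metric.closedBall x (2 * ρ), (|b y - ballAvg μ b x (2 * ρ)| +
          |ballAvg μ b x (2 * ρ) - ballAvg μ b x ρ|) ∂μ :=
        integral_mono (hint _) ((hint _).add hconst) fun y => abs_sub_le _ _ _
    _ = (∫ y in Metric.closedBall x (2 * ρ), |b y - ballAvg μ b x (2 * ρ)| ∂μ) +
          μ.real (Metric.closedBall x (2 * ρ)) *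
            |ballAvg μ b x (2 * ρ) - ballAvg μ b x ρ| := by
        rw [integral_add (hint _) hconst, setIntegral_const, smul_eq_mul]
    _ ≤ K * μ.real (Metric.closedBall x (2 * ρ)) +
          μ.real (Metric.closedBall x (2 * ρ)) * (2 ^ Module.finrank ℝ E * K) := by
        gcongr
        · exact hK x _ (by linarith)
        · exact abs_ballAvg_two_mul_sub_le hb hK x hρ
    _ = _ := by rw [h2]; ring

end BallOscillation

section JohnNirenberg

open Metric

variable {E : Type*} [NormedAddCommGroup E] [NormedSpace ℝ E] [FiniteDimensional ℝ E]
  [MeasurableSpace E] [BorelSpace E] {μ : Measure E} [μ.IsAddHaarMeasure]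

/-- Stopping-time covering of the set where a locally integrable function `h` exceeds a high
level `L` on a ball `B(x₀, R)`. -/
theorem exists_stopping_family {h : E → ℝ} (hh : LocallyIntegrable h μ) (h0 : ∀ y, 0 ≤ h y)
    {x₀ : E} {R L C : ℝ} (hR : 0 < R) (hL : 0 < L)
    (hC : ∫ y in closedBall x₀ (2 * R), h y ∂μ ≤ C * μ.real (closedBall x₀ R)) (hCL : C ≤ L) :
    ∃ (U : Set E) (t : E → ℝ), U.Countable ∧ (∀ x ∈ U, 0 < t x) ∧
      (∀ x ∈ U, ⨍ y in closedBall x (5 * t x), h y ∂μ ≤ L) ∧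
      (∑' x : U, μ (closedBall x.1 (t x.1))) ≤
        ENNReal.ofReal (C / L) * μ (closedBall x₀ R) ∧
      ∀ᵐ y ∂μ, y ∈ closedBall x₀ R → y ∉ ⋃ x : U, closedBall x.1 (5 * t x.1) → h y ≤ L := by
  have hint : ∀ x r, IntegrableOn h (closedBall x r) μ := fun x r =>
    hh.integrableOn_isCompact (isCompact_closedBall x r)
  set S : Set E := {x | x ∈ closedBall x₀ R ∧
    Tendsto (fun t => ⨍ y in closedBall x t, h y ∂μ) (𝓝[>] 0) (𝓝 (h x)) ∧ L < h x} with hS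
  have hex : ∀ x, ∃ t : ℝ, x ∈ S → (0 < t ∧ 5 * t ≤ R ∧ L < ⨍ y in closedBall x t, h y ∂μ ∧
      ⨍ y in closedBall x (5 * t), h y ∂μ ≤ L) := by
    intro x
    by_cases hx : x ∈ S
    · have hRL : ⨍ y in closedBall x R, h y ∂μ ≤ L := by
        have hpos := measureReal_closedBall_pos μ x₀ hR
        have heq : μ.real (closedBall x R) = μ.real (closedBall x₀ R) := by
          rw [measureReal_def, measureReal_def, Measure.addHaar_closedBall_center μ x,
            Measure.addHaar_closedBall_center μ x₀]
        rw [setAverage_eq, smul_eq_mul, heq, inv_mul_le_iff₀ hpos]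
        calc ∫ y in closedBall x R, h y ∂μ ≤ ∫ y in closedBall x₀ (2 * R), h y ∂μ := by
              refine setIntegral_mono_set (hint _ _) (ae_of_all _ h0)
                (closedBall_subset_closedBall' ?_).eventuallyLE
              have := mem_closedBall.1 hx.1
              linarith
          _ ≤ _ := hC
          _ ≤ μ.real (closedBall x₀ R) * L := by
              rw [mul_comm]; gcongr
      obtain ⟨t, ht⟩ := exists_stopping_radius hR hx.2.1 hx.2.2 hRL
      exact ⟨t, fun _ => ht⟩
    · exact ⟨0, fun h => absurd h hx⟩
  choose t ht using hex
  obtain ⟨U, hUS, hdisj, hcov⟩ := Vitali.exists_disjoint_subfamily_covering_enlargement_closedBall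
    S id t R (fun a ha => by have := ht a ha; linarith [this.1, this.2.1]) 5 (by norm_num)
  have hUc : U.Countable := hdisj.countable_of_nonempty_interior fun x hx => by
    refine ⟨x, ?_⟩
    exact ball_subset_interior_closedBall (mem_ball_self (ht x (hUS hx)).1)
  refine ⟨U, t, hUc, fun x hx => (ht x (hUS hx)).1, fun x hx => (ht x (hUS hx)).2.2.2, ?_, ?_⟩
  · have hball : ∀ x : U, μ (closedBall x.1 (t x.1)) ≤
        ENNReal.ofReal (1 / L) * ∫⁻ y in closedBall x.1 (t x.1), ENNReal.ofReal (h y) ∂μ := by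
      intro x
      have hx := ht x.1 (hUS x.2)
      have hpos := measureReal_closedBall_pos μ x.1 hx.1
      rw [← ofReal_integral_eq_lintegral_ofReal (hint _ _) (ae_of_all _ h0),
        ← ENNReal.ofReal_mul (by positivity),
        ← ENNReal.ofReal_toReal (measure_closedBall_lt_top (μ := μ) (x := x.1) (r := t x.1)).ne]
      refine ENNReal.ofReal_le_ofReal ?_
      have h1 := hx.2.2.1.le
      rw [setAverage_eq, smul_eq_mul, le_inv_mul_iff₀ hpos] at h1
      rw [← measureReal_def, one_div, le_inv_mul_iff₀ hL]
      linarith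
    have : Countable U := hUc.to_subtype
    calc (∑' x : U, μ (closedBall x.1 (t x.1)))
        ≤ ∑' x : U, ENNReal.ofReal (1 / L) *
            ∫⁻ y in closedBall x.1 (t x.1), ENNReal.ofReal (h y) ∂μ := ENNReal.tsum_le_tsum hball
      _ = ENNReal.ofReal (1 / L) *
            ∫⁻ y in ⋃ x : U, closedBall x.1 (t x.1), ENNReal.ofReal (h y) ∂μ := by
          rw [ENNReal.tsum_mul_left, lintegral_iUnion (fun x => measurableSet_closedBall)]
          exact fun x y hxy => hdisj x.2 y.2 (fun h => hxy (Subtype.ext h))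
      _ ≤ ENNReal.ofReal (1 / L) *
            ∫⁻ y in closedBall x₀ (2 * R), ENNReal.ofReal (h y) ∂μ := by
          gcongr
          refine Set.iUnion_subset fun x => closedBall_subset_closedBall' ?_
          have hx := ht x.1 (hUS x.2)
          have := mem_closedBall.1 (hUS x.2).1
          linarith [hx.1, hx.2.1]
      _ ≤ ENNReal.ofReal (1 / L) * ENNReal.ofReal (C * μ.real (closedBall x₀ R)) := by
          rw [← ofReal_integral_eq_lintegral_ofReal (hint _ _) (ae_of_all _ h0)]
          gcongr
      _ = ENNReal.ofReal (C / L) * μ (closedBall x₀ R) := by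
          rw [← ENNReal.ofReal_mul (by positivity), ← mul_assoc,
            ENNReal.ofReal_mul' measureReal_nonneg, measureReal_def,
            ENNReal.ofReal_toReal measure_closedBall_lt_top.ne]
          congr 2; ring
  · filter_upwards [IsUnifLocDoublingMeasure.ae_tendsto_average (μ := μ) hh 1] with y hy hyB hyU
    by_contra hlt
    refine hyU ?_
    have hyS : y ∈ S := by
      refine ⟨hyB, ?_, not_le.1 hlt⟩
      refine hy (fun _ => y) (fun t => t) tendsto_id ?_
      filter_upwards [self_mem_nhdsWithin] with s hs
      exact mem_closedBall_self (by simpa using (Set.mem_Ioi.1 hs).le)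
    obtain ⟨x, hxU, hx⟩ := hcov y hyS
    exact Set.mem_iUnion.2 ⟨⟨x, hxU⟩, hx (mem_closedBall_self (ht y hyS).1.le)⟩

/-- Self-improvement step in the John–Nirenberg inequality for truncated oscillations. -/
theorem lintegral_truncated_osc_pow_le {b : E → ℝ} (hb : LocallyIntegrable b μ) {K : ℝ}
    (hK0 : 0 < K) (hK : BallOscLE μ b K) (N : ℕ) {M L : ℝ} (hM : 0 < M)
    (hL : L = 2 * 2 ^ N * 5 ^ Module.finrank ℝ E *
      (2 ^ Module.finrank ℝ E * (1 + 2 ^ Module.finrank ℝ E) * K))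
    {A : ℝ≥0∞} (hA : ∀ x ρ, 0 < ρ →
      ∫⁻ y in closedBall x ρ, ENNReal.ofReal (min |b y - ballAvg μ b x ρ| M ^ N) ∂μ ≤
        A * μ (closedBall x ρ)) (x₀ : E) {R : ℝ} (hR : 0 < R) :
    ∫⁻ y in closedBall x₀ R, ENNReal.ofReal (min |b y - ballAvg μ b x₀ R| M ^ N) ∂μ ≤
      (ENNReal.ofReal (L ^ N) + 2⁻¹ * (A + ENNReal.ofReal (L ^ N))) * μ (closedBall x₀ R) := by
  set d := Module.finrank ℝ E
  set C := (2 : ℝ) ^ d * (1 + 2 ^ d) * K with hC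
  have hC0 : 0 < C := by positivity
  have hL0 : 0 < L := by rw [hL]; positivity
  have hCL : C ≤ L := by
    rw [hL]
    refine le_mul_of_one_le_left hC0.le ?_
    have h2 : (1 : ℝ) ≤ 2 ^ N := one_le_pow₀ (by norm_num)
    have h5 : (1 : ℝ) ≤ 5 ^ d := one_le_pow₀ (by norm_num)
    nlinarith
  set a := ballAvg μ b x₀ R
  obtain ⟨U, t, hUc, htpos, havg, hsum, hae⟩ := exists_stopping_family
    (locallyIntegrable_abs_sub_const hb a) (fun y => abs_nonneg _) hR hL0
    (setIntegral_closedBall_two_mul_le hb hK x₀ hR) hCL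
  have : Countable U := hUc.to_subtype
  set W : Set E := ⋃ x : U, closedBall x.1 (5 * t x.1)
  have hWm : MeasurableSet W := MeasurableSet.iUnion fun x => measurableSet_closedBall
  have hballs : ∀ x : U, ∫⁻ y in closedBall x.1 (5 * t x.1),
      ENNReal.ofReal (min |b y - a| M ^ N) ∂μ ≤
      ENNReal.ofReal (2 ^ N * 5 ^ d) * (A + ENNReal.ofReal (L ^ N)) *
        μ (closedBall x.1 (t x.1)) := by
    intro x
    have htx := htpos x.1 x.2
    have h5 : 0 < 5 * t x.1 := by linarith
    have hm : |ballAvg μ b x.1 (5 * t x.1) - a| ≤ L := by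
      refine (abs_setAverage_sub_le (hb.integrableOn_isCompact (isCompact_closedBall _ _))
        (measureReal_closedBall_pos μ x.1 h5) a).trans ?_
      have := havg x.1 x.2
      rwa [setAverage_eq, smul_eq_mul, inv_mul_eq_div] at this
    have hpt : ∀ y, ENNReal.ofReal (min |b y - a| M ^ N) ≤ ENNReal.ofReal (2 ^ N) *
        (ENNReal.ofReal (min |b y - ballAvg μ b x.1 (5 * t x.1)| M ^ N) +
          ENNReal.ofReal (L ^ N)) := by
      intro y
      rw [← ENNReal.ofReal_add (by positivity) (by positivity),
        ← ENNReal.ofReal_mul (by positivity)]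
      refine ENNReal.ofReal_le_ofReal ?_
      set m := ballAvg μ b x.1 (5 * t x.1)
      have h1 : |b y - a| ≤ |b y - m| + L := (abs_sub_le _ m _).trans (by gcongr)
      have h2 : min |b y - a| M ≤ min |b y - m| M + L := by
        rcases le_total |b y - m| M with h | h
        · rw [min_eq_left h]; exact (min_le_left _ _).trans h1
        · rw [min_eq_right h]; exact (min_le_right _ _).trans (by linarith)
      have h3 : (0 : ℝ) ≤ min |b y - m| M := by positivity
      calc min |b y - a| M ^ N ≤ (min |b y - m| M + L) ^ N := by gcongr
        _ ≤ 2 ^ (N - 1) * (min |b y - m| M ^ N + L ^ N) := add_pow_le h3 hL0.le N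
        _ ≤ 2 ^ N * (min |b y - m| M ^ N + L ^ N) := by
            gcongr
            · norm_num
            · omega
    calc _ ≤ ∫⁻ y in closedBall x.1 (5 * t x.1), ENNReal.ofReal (2 ^ N) *
          (ENNReal.ofReal (min |b y - ballAvg μ b x.1 (5 * t x.1)| M ^ N) +
            ENNReal.ofReal (L ^ N)) ∂μ := lintegral_mono hpt
      _ = ENNReal.ofReal (2 ^ N) * ((∫⁻ y in closedBall x.1 (5 * t x.1),
          ENNReal.ofReal (min |b y - ballAvg μ b x.1 (5 * t x.1)| M ^ N) ∂μ) +
            ENNReal.ofReal (L ^ N) * μ (closedBall x.1 (5 * t x.1))) := by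
          rw [lintegral_const_mul' _ _ ENNReal.ofReal_ne_top,
            lintegral_add_right _ measurable_const, setLIntegral_const]
      _ ≤ ENNReal.ofReal (2 ^ N) * (A * μ (closedBall x.1 (5 * t x.1)) +
            ENNReal.ofReal (L ^ N) * μ (closedBall x.1 (5 * t x.1))) := by
          gcongr
          exact hA _ _ h5
      _ = _ := by
          rw [Measure.addHaar_closedBall_mul μ x.1 (by norm_num) htx.le,
            Measure.addHaar_closedBall_center μ x.1, ENNReal.ofReal_mul (by positivity)]
          ring
  calc _ ≤ ∫⁻ y in (closedBall x₀ R \ W) ∪ W, ENNReal.ofReal (min |b y - a| M ^ N) ∂μ := by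
        refine lintegral_mono_set fun y hy => ?_
        by_cases hyW : y ∈ W
        · exact Or.inr hyW
        · exact Or.inl ⟨hy, hyW⟩
    _ ≤ _ := lintegral_union_le _ _ _
    _ ≤ ENNReal.ofReal (L ^ N) * μ (closedBall x₀ R) +
        2⁻¹ * (A + ENNReal.ofReal (L ^ N)) * μ (closedBall x₀ R) := ?_
    _ = _ := by ring
  refine add_le_add ?_ ?_
  · calc _ ≤ ∫⁻ y in closedBall x₀ R \ W, ENNReal.ofReal (L ^ N) ∂μ := by
          refine lintegral_mono_ae ?_
          filter_upwards [ae_restrict_of_ae hae,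
            ae_restrict_mem (measurableSet_closedBall.diff hWm)] with y hy hyB
          refine ENNReal.ofReal_le_ofReal ?_
          have h3 : (0 : ℝ) ≤ min |b y - a| M := by positivity
          gcongr
          exact (min_le_left _ _).trans (hy hyB.1 hyB.2)
      _ ≤ _ := by
          rw [setLIntegral_const]
          gcongr
          exact Set.sdiff_subset
  · calc _ ≤ ∑' x : U, ∫⁻ y in closedBall x.1 (5 * t x.1),
          ENNReal.ofReal (min |b y - a| M ^ N) ∂μ := lintegral_iUnion_le _ _
      _ ≤ ∑' x : U, ENNReal.ofReal (2 ^ N * 5 ^ d) * (A + ENNReal.ofReal (L ^ N)) *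
          μ (closedBall x.1 (t x.1)) := ENNReal.tsum_le_tsum hballs
      _ ≤ ENNReal.ofReal (2 ^ N * 5 ^ d) * (A + ENNReal.ofReal (L ^ N)) *
          (ENNReal.ofReal (C / L) * μ (closedBall x₀ R)) := by
          rw [ENNReal.tsum_mul_left]
          gcongr
      _ = ENNReal.ofReal (2 ^ N * 5 ^ d * (C / L)) * (A + ENNReal.ofReal (L ^ N)) *
          μ (closedBall x₀ R) := by
          rw [ENNReal.ofReal_mul (p := 2 ^ N * 5 ^ d) (by positivity)]
          ring
      _ = _ := by
          have : (2 : ℝ) ^ N * 5 ^ d * (C / L) = 2⁻¹ := by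
            rw [hL]; field_simp
          rw [this, ENNReal.ofReal_inv_of_pos (by norm_num)]
          norm_num

/-- **John–Nirenberg**: functions of bounded mean oscillation on balls have bounded
oscillation in every `L^N`. -/
theorem exists_lintegral_osc_pow_le (K : ℝ) (hK0 : 0 < K) (N : ℕ) :
    ∃ C : ℝ, 0 < C ∧ ∀ b : E → ℝ, LocallyIntegrable b μ → BallOscLE μ b K →
      ∀ x ρ, 0 < ρ → ∫⁻ y in closedBall x ρ,
        ENNReal.ofReal (|b y - ballAvg μ b x ρ| ^ N) ∂μ ≤
        ENNReal.ofReal C * μ (closedBall x ρ) := by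
  set L : ℝ := 2 * 2 ^ N * 5 ^ Module.finrank ℝ E *
      (2 ^ Module.finrank ℝ E * (1 + 2 ^ Module.finrank ℝ E) * K) with hL
  have hL0 : 0 < L := by positivity
  refine ⟨3 * L ^ N, by positivity, fun b hb hK x₀ R hR => ?_⟩
  have htrunc : ∀ M : ℝ, 0 < M → ∀ x ρ, 0 < ρ →
      ∫⁻ y in closedBall x ρ, ENNReal.ofReal (min |b y - ballAvg μ b x ρ| M ^ N) ∂μ ≤
        ENNReal.ofReal (3 * L ^ N) * μ (closedBall x ρ) := by
    intro M hM
    set A : ℝ≥0∞ := ⨆ (x : E) (ρ : {ρ : ℝ // 0 < ρ}),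
      (∫⁻ y in closedBall x ρ.1, ENNReal.ofReal (min |b y - ballAvg μ b x ρ.1| M ^ N) ∂μ) /
        μ (closedBall x ρ.1) with hAdef
    have hA : ∀ x ρ, 0 < ρ →
        ∫⁻ y in closedBall x ρ, ENNReal.ofReal (min |b y - ballAvg μ b x ρ| M ^ N) ∂μ ≤
          A * μ (closedBall x ρ) := by
      intro x ρ hρ
      rw [← ENNReal.div_le_iff (measure_closedBall_pos μ x hρ).ne' measure_closedBall_lt_top.ne]
      exact le_iSup₂_of_le (f := fun (x : E) (ρ : {ρ : ℝ // 0 < ρ}) =>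
        (∫⁻ y in closedBall x ρ.1, ENNReal.ofReal (min |b y - ballAvg μ b x ρ.1| M ^ N) ∂μ) /
        μ (closedBall x ρ.1)) x ⟨ρ, hρ⟩ le_rfl
    have hAtop : A ≤ ENNReal.ofReal (M ^ N) := by
      refine iSup₂_le fun x ρ => ?_
      rw [ENNReal.div_le_iff (measure_closedBall_pos μ x ρ.2).ne' measure_closedBall_lt_top.ne,
        ← setLIntegral_const]
      refine lintegral_mono fun y => ENNReal.ofReal_le_ofReal ?_
      have h3 : (0 : ℝ) ≤ min |b y - ballAvg μ b x ρ.1| M := by positivity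
      gcongr
      exact min_le_right _ _
    have hAle : A ≤ ENNReal.ofReal (L ^ N) + 2⁻¹ * (A + ENNReal.ofReal (L ^ N)) := by
      refine iSup₂_le fun x ρ => ?_
      rw [ENNReal.div_le_iff (measure_closedBall_pos μ x ρ.2).ne' measure_closedBall_lt_top.ne]
      exact lintegral_truncated_osc_pow_le hb hK0 hK N hM hL hA x ρ.2
    have hAfin : A ≠ ∞ := (hAtop.trans_lt ENNReal.ofReal_lt_top).ne
    have hA3 : A ≤ ENNReal.ofReal (3 * L ^ N) := by
      rw [← ENNReal.ofReal_toReal hAfin] at hAle ⊢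
      have h2 : (2⁻¹ : ℝ≥0∞) = ENNReal.ofReal 2⁻¹ := by
        rw [ENNReal.ofReal_inv_of_pos (by norm_num)]; norm_num
      rw [h2, ← ENNReal.ofReal_add (by positivity) (by positivity),
        ← ENNReal.ofReal_mul (by positivity),
        ← ENNReal.ofReal_add (by positivity) (by positivity),
        ENNReal.ofReal_le_ofReal_iff (by positivity)] at hAle
      refine ENNReal.ofReal_le_ofReal ?_
      linarith
    intro x ρ hρ
    exact (hA x ρ hρ).trans (by gcongr)
  have hlim : ∀ y, Tendsto (fun M : ℕ =>
      ENNReal.ofReal (min |b y - ballAvg μ b x₀ R| ((M : ℝ) + 1) ^ N)) atTop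
      (𝓝 (ENNReal.ofReal (|b y - ballAvg μ b x₀ R| ^ N))) := by
    intro y
    refine tendsto_const_nhds.congr' ?_
    obtain ⟨k, hk⟩ := exists_nat_ge |b y - ballAvg μ b x₀ R|
    filter_upwards [eventually_ge_atTop k] with M hM
    have : (k : ℝ) ≤ M := by exact_mod_cast hM
    rw [min_eq_left (by linarith)]
  have hmeas : AEMeasurable b (μ.restrict (closedBall x₀ R)) :=
    (hb.aestronglyMeasurable.aemeasurable).restrict
  calc ∫⁻ y in closedBall x₀ R, ENNReal.ofReal (|b y - ballAvg μ b x₀ R| ^ N) ∂μ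
      = ∫⁻ y in closedBall x₀ R, liminf (fun M : ℕ =>
          ENNReal.ofReal (min |b y - ballAvg μ b x₀ R| ((M : ℝ) + 1) ^ N)) atTop ∂μ :=
        lintegral_congr fun y => (hlim y).liminf_eq.symm
    _ ≤ liminf (fun M : ℕ => ∫⁻ y in closedBall x₀ R,
          ENNReal.ofReal (min |b y - ballAvg μ b x₀ R| ((M : ℝ) + 1) ^ N) ∂μ) atTop := by
        refine lintegral_liminf_le' fun M => ?_
        exact ((((hmeas.sub_const _).abs).min aemeasurable_const).pow_const N).ennreal_ofReal
    _ ≤ liminf (fun _ : ℕ => ENNReal.ofReal (3 * L ^ N) * μ (closedBall x₀ R)) atTop :=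
        liminf_le_liminf (Eventually.of_forall fun M =>
          htrunc _ (by positivity) x₀ R hR)
    _ = _ := by simp

end JohnNirenberg

section WeightedOscillation

open Metric

variable {E : Type*} [NormedAddCommGroup E] [NormedSpace ℝ E] [FiniteDimensional ℝ E]
  [MeasurableSpace E] [BorelSpace E] {μ : Measure E} [μ.IsAddHaarMeasure]

theorem abs_ballAvg_two_pow_mul_sub_le {b : E → ℝ} (hb : LocallyIntegrable b μ) {K : ℝ}
    (hK : BallOscLE μ b K) (x : E) {r : ℝ} (hr : 0 < r) (k : ℕ) :
    |ballAvg μ b x (2 ^ k * r) - ballAvg μ b x r| ≤ k * (2 ^ Module.finrank ℝ E * K) := by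
  induction k with
  | zero => simp
  | succ k ih =>
    have h1 := abs_ballAvg_two_mul_sub_le hb hK x (ρ := 2 ^ k * r) (by positivity)
    have h2 : (2 : ℝ) ^ (k + 1) * r = 2 * (2 ^ k * r) := by ring
    rw [h2]
    refine (abs_sub_le _ (ballAvg μ b x (2 ^ k * r)) _).trans ?_
    push_cast
    linarith

theorem add_pow_le_two_pow {a b : ℝ} (ha : 0 ≤ a) (hb : 0 ≤ b) (N : ℕ) :
    (a + b) ^ N ≤ 2 ^ N * (a ^ N + b ^ N) := by
  refine (add_pow_le ha hb N).trans ?_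
  gcongr
  · norm_num
  · omega

/-- Pointwise dyadic bound for a power weight. -/
theorem ofReal_one_add_rpow_neg_le_tsum {s ρ : ℝ} (hs : 0 ≤ s) (hρ : 0 ≤ ρ) :
    ENNReal.ofReal ((1 + ρ) ^ (-s)) ≤
      ∑' k : ℕ, ENNReal.ofReal (2 ^ s * ((2 : ℝ) ^ (-s)) ^ k) *
        (Set.Iic ((2 : ℝ) ^ k)).indicator 1 ρ := by
  classical
  have hex : ∃ k : ℕ, ρ ≤ (2 : ℝ) ^ k := by
    obtain ⟨k, hk⟩ := pow_unbounded_of_one_lt ρ (one_lt_two (α := ℝ))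
    exact ⟨k, hk.le⟩
  have hspec := Nat.find_spec hex
  refine le_trans ?_ (ENNReal.le_tsum (Nat.find hex))
  rw [Set.indicator_of_mem (Set.mem_Iic.2 hspec), Pi.one_apply, mul_one]
  refine ENNReal.ofReal_le_ofReal ?_
  rcases hk : Nat.find hex with _ | k
  · rw [pow_zero, mul_one]
    calc (1 + ρ) ^ (-s) ≤ 1 := Real.rpow_le_one_of_one_le_of_nonpos (by linarith) (by linarith)
      _ ≤ 2 ^ s := Real.one_le_rpow (by norm_num) hs
  · have hmin := not_le.1 (Nat.find_min hex (m := k) (by omega))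
    calc (1 + ρ) ^ (-s) ≤ ((2 : ℝ) ^ k) ^ (-s) :=
          Real.rpow_le_rpow_of_nonpos (by positivity) (by linarith) (by linarith)
      _ = 2 ^ s * ((2 : ℝ) ^ (-s)) ^ (k + 1) := by
          rw [pow_succ, mul_comm (((2 : ℝ) ^ (-s)) ^ k), ← mul_assoc,
            ← Real.rpow_add (by norm_num), add_neg_cancel, Real.rpow_zero, one_mul,
            ← Real.rpow_natCast, ← Real.rpow_natCast, ← Real.rpow_mul (by norm_num),
            ← Real.rpow_mul (by norm_num), mul_comm]

theorem exists_lintegral_weighted_osc_le (K : ℝ) (hK0 : 0 < K) (N : ℕ) {η : ℝ} (hη : 0 < η) :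
    ∃ C : ℝ, 0 < C ∧ ∀ b : E → ℝ, LocallyIntegrable b μ → BallOscLE μ b K →
      ∀ x r, 0 < r → ∫⁻ y, ENNReal.ofReal ((1 + |b y - ballAvg μ b x r|) ^ N *
        (1 + ‖y - x‖ / r) ^ (-(Module.finrank ℝ E + η))) ∂μ ≤
        ENNReal.ofReal C * μ (closedBall x r) := by
  obtain ⟨CN, hCN0, hCN⟩ := exists_lintegral_osc_pow_le (μ := μ) K hK0 N
  set d := Module.finrank ℝ E
  set D : ℝ := 2 ^ d * K with hD
  set s : ℝ := d + η with hs
  have hD0 : 0 < D := by positivity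
  have hs0 : 0 < s := by positivity
  set a : ℕ → ℝ := fun k => 2 ^ s * ((2 : ℝ) ^ (-s)) ^ k *
    (2 ^ N * (CN + (1 + k * D) ^ N) * (2 ^ k) ^ d) with ha
  have ha0 : ∀ k, 0 ≤ a k := fun k => by positivity
  have hasum : Summable a := by
    set θ : ℝ := 2 ^ (-η) with hθ
    have hθ0 : 0 ≤ θ := by positivity
    have hθ1 : ‖θ‖ < 1 := by
      rw [Real.norm_of_nonneg hθ0]
      exact Real.rpow_lt_one_of_one_lt_of_neg (by norm_num) (by linarith)
    have hgeo : Summable fun k : ℕ => θ ^ k := summable_geometric_of_norm_lt_one hθ1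
    have hpg : Summable fun k : ℕ => (k : ℝ) ^ N * θ ^ k :=
      summable_pow_mul_geometric_of_norm_lt_one N hθ1
    refine Summable.of_nonneg_of_le ha0 (fun k => ?_)
      ((hgeo.mul_left (2 ^ s * 2 ^ N * (CN + 2 ^ N))).add
        (hpg.mul_left (2 ^ s * 2 ^ N * 2 ^ N * D ^ N)))
    have h1 : ((2 : ℝ) ^ (-s)) ^ k * (2 ^ k) ^ d = θ ^ k := by
      rw [← pow_mul, mul_comm k d, pow_mul, ← mul_pow, hθ, ← Real.rpow_natCast 2 d,
        ← Real.rpow_add (by norm_num)]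
      congr 2
      rw [hs]; ring
    have h2 := add_pow_le_two_pow (zero_le_one (α := ℝ)) (b := k * D) (by positivity) N
    rw [one_pow, mul_pow] at h2
    calc a k = 2 ^ s * 2 ^ N * (CN + (1 + k * D) ^ N) * θ ^ k := by rw [← h1, ha]; ring
      _ ≤ 2 ^ s * 2 ^ N * (CN + 2 ^ N * (1 + (k : ℝ) ^ N * D ^ N)) * θ ^ k := by gcongr
      _ = _ := by ring
  have htpos : 0 < ∑' k, a k := hasum.tsum_pos ha0 0 (by simp only [ha]; positivity)
  refine ⟨∑' k, a k, htpos, fun b hb hK x r hr => ?_⟩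
  have hball : ∀ k : ℕ, ∫⁻ y in closedBall x (2 ^ k * r),
      ENNReal.ofReal ((1 + |b y - ballAvg μ b x r|) ^ N) ∂μ ≤
      ENNReal.ofReal (2 ^ N * (CN + (1 + k * D) ^ N) * (2 ^ k) ^ d) * μ (closedBall x r) := by
    intro k
    have hpt : ∀ y, ENNReal.ofReal ((1 + |b y - ballAvg μ b x r|) ^ N) ≤
        ENNReal.ofReal (2 ^ N) * (ENNReal.ofReal (|b y - ballAvg μ b x (2 ^ k * r)| ^ N) +
          ENNReal.ofReal ((1 + k * D) ^ N)) := by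
      intro y
      rw [← ENNReal.ofReal_add (by positivity) (by positivity),
        ← ENNReal.ofReal_mul (by positivity)]
      refine ENNReal.ofReal_le_ofReal ?_
      refine le_trans ?_ (add_pow_le_two_pow (abs_nonneg _) (by positivity) N)
      have h1 := abs_ballAvg_two_pow_mul_sub_le hb hK x hr k
      have h2 := abs_sub_le (b y) (ballAvg μ b x (2 ^ k * r)) (ballAvg μ b x r)
      gcongr ?_ ^ N
      linarith
    calc _ ≤ ∫⁻ y in closedBall x (2 ^ k * r), ENNReal.ofReal (2 ^ N) *
          (ENNReal.ofReal (|b y - ballAvg μ b x (2 ^ k * r)| ^ N) +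
            ENNReal.ofReal ((1 + k * D) ^ N)) ∂μ := lintegral_mono hpt
      _ = ENNReal.ofReal (2 ^ N) * ((∫⁻ y in closedBall x (2 ^ k * r),
          ENNReal.ofReal (|b y - ballAvg μ b x (2 ^ k * r)| ^ N) ∂μ) +
            ENNReal.ofReal ((1 + k * D) ^ N) * μ (closedBall x (2 ^ k * r))) := by
          rw [lintegral_const_mul' _ _ ENNReal.ofReal_ne_top,
            lintegral_add_right _ measurable_const, setLIntegral_const]
      _ ≤ ENNReal.ofReal (2 ^ N) * (ENNReal.ofReal CN * μ (closedBall x (2 ^ k * r)) +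
            ENNReal.ofReal ((1 + k * D) ^ N) * μ (closedBall x (2 ^ k * r))) := by
          gcongr
          exact hCN b hb hK x _ (by positivity)
      _ = _ := by
          rw [← add_mul, ← ENNReal.ofReal_add hCN0.le (by positivity), ← mul_assoc,
            ← ENNReal.ofReal_mul (by positivity),
            Measure.addHaar_closedBall_mul μ x (by positivity) hr.le,
            Measure.addHaar_closedBall_center μ x, ← mul_assoc,
            ← ENNReal.ofReal_mul (by positivity)]
  have hmeas : AEMeasurable (fun y => ENNReal.ofReal ((1 + |b y - ballAvg μ b x r|) ^ N)) μ :=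
    ((((hb.aestronglyMeasurable.aemeasurable).sub_const _).abs.const_add 1).pow_const
      N).ennreal_ofReal
  calc _ ≤ ∫⁻ y, ∑' k : ℕ, ENNReal.ofReal (2 ^ s * ((2 : ℝ) ^ (-s)) ^ k) *
        (closedBall x (2 ^ k * r)).indicator
          (fun y => ENNReal.ofReal ((1 + |b y - ballAvg μ b x r|) ^ N)) y ∂μ := by
        refine lintegral_mono fun y => ?_
        rw [ENNReal.ofReal_mul (by positivity)]
        refine (mul_le_mul_right (ofReal_one_add_rpow_neg_le_tsum hs0.le
          (by positivity)) _).trans ?_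
        rw [← ENNReal.tsum_mul_left]
        refine ENNReal.tsum_le_tsum fun k => ?_
        by_cases hy : y ∈ closedBall x (2 ^ k * r)
        · rw [Set.indicator_of_mem hy, mul_comm]
          gcongr
          refine mul_le_of_le_one_right' ?_
          exact Set.indicator_le_self' (fun _ _ => zero_le) _
        · rw [Set.indicator_of_notMem hy, Set.indicator_of_notMem, mul_zero, mul_zero]
          rw [mem_closedBall, dist_eq_norm] at hy
          rwa [Set.mem_Iic, div_le_iff₀ hr]
    _ = ∑' k : ℕ, ENNReal.ofReal (2 ^ s * ((2 : ℝ) ^ (-s)) ^ k) *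
        ∫⁻ y in closedBall x (2 ^ k * r),
          ENNReal.ofReal ((1 + |b y - ballAvg μ b x r|) ^ N) ∂μ := by
        rw [lintegral_tsum fun k => (hmeas.indicator measurableSet_closedBall).const_mul _]
        refine tsum_congr fun k => ?_
        rw [lintegral_const_mul' _ _ ENNReal.ofReal_ne_top,
          lintegral_indicator measurableSet_closedBall]
    _ ≤ ∑' k : ℕ, ENNReal.ofReal (a k) * μ (closedBall x r) := by
        refine ENNReal.tsum_le_tsum fun k => ?_
        have hk : ENNReal.ofReal (a k) = ENNReal.ofReal (2 ^ s * ((2 : ℝ) ^ (-s)) ^ k) *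
            ENNReal.ofReal (2 ^ N * (CN + (1 + k * D) ^ N) * (2 ^ k) ^ d) :=
          ENNReal.ofReal_mul (by positivity)
        rw [hk, mul_assoc]
        exact mul_le_mul_right (hball k) _
    _ = _ := by
        rw [ENNReal.tsum_mul_right, ENNReal.ofReal_tsum_of_nonneg ha0 hasum]

end WeightedOscillation

section Cubes

open Metric

theorem cube_eq_preimage (n : ℕ) (c : Rn n) (r : ℝ) :
    cube n c r = (WithLp.ofLp : Rn n → Fin n → ℝ) ⁻¹'
      Set.pi Set.univ fun i => Set.Icc (c i - r / 2) (c i + r / 2) := by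
  ext y
  simp only [cube, Set.mem_ofPred_eq, Set.mem_preimage, Set.mem_pi, Set.mem_univ, forall_const,
    Set.mem_Icc, abs_le]
  refine forall_congr' fun i => ?_
  constructor <;> rintro ⟨h1, h2⟩ <;> constructor <;> linarith

theorem isClosed_cube (n : ℕ) (c : Rn n) (r : ℝ) : IsClosed (cube n c r) := by
  rw [cube_eq_preimage]
  exact (isClosed_set_pi fun i _ => isClosed_Icc).preimage (PiLp.continuous_ofLp 2 _)

theorem measurableSet_cube (n : ℕ) (c : Rn n) (r : ℝ) : MeasurableSet (cube n c r) :=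
  (isClosed_cube n c r).measurableSet

theorem volume_cube (n : ℕ) (c : Rn n) {r : ℝ} (hr : 0 ≤ r) :
    volume (cube n c r) = ENNReal.ofReal (r ^ n) := by
  rw [cube_eq_preimage, (PiLp.volume_preserving_ofLp (Fin n)).measure_preimage
    (MeasurableSet.univ_pi fun i => measurableSet_Icc).nullMeasurableSet, volume_pi_pi]
  simp only [Real.volume_Icc]
  have : ∀ i, c i + r / 2 - (c i - r / 2) = r := fun i => by ring
  simp [this, ENNReal.ofReal_pow hr]

theorem volume_cube_toReal (n : ℕ) (c : Rn n) {r : ℝ} (hr : 0 ≤ r) :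
    (volume (cube n c r)).toReal = r ^ n := by
  rw [volume_cube n c hr, ENNReal.toReal_ofReal (by positivity)]

theorem closedBall_subset_cube (n : ℕ) (c : Rn n) (ρ : ℝ) :
    closedBall c ρ ⊆ cube n c (2 * ρ) := by
  intro y hy i
  rw [mem_closedBall, dist_eq_norm] at hy
  have := PiLp.norm_apply_le (y - c) i
  rw [PiLp.sub_apply, Real.norm_eq_abs] at this
  linarith

theorem norm_sub_le_of_mem_cube {n : ℕ} {c y : Rn n} {r : ℝ} (hr : 0 ≤ r)
    (hy : y ∈ cube n c r) : ‖y - c‖ ≤ √n * r / 2 := by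
  refine le_of_sq_le_sq ?_ (by positivity)
  rw [EuclideanSpace.norm_sq_eq, div_pow, mul_pow, Real.sq_sqrt (Nat.cast_nonneg n)]
  calc ∑ i, ‖(y - c) i‖ ^ 2 ≤ ∑ _i : Fin n, (r / 2) ^ 2 := by
        refine Finset.sum_le_sum fun i _ => ?_
        rw [PiLp.sub_apply, Real.norm_eq_abs]
        gcongr
        exact hy i
    _ = _ := by
        rw [Finset.sum_const, Finset.card_univ, Fintype.card_fin, nsmul_eq_mul]; ring

theorem cube_subset_closedBall (n : ℕ) (c : Rn n) {r : ℝ} (hr : 0 ≤ r) :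
    cube n c r ⊆ closedBall c (√n * r) := by
  intro y hy
  rw [mem_closedBall, dist_eq_norm]
  have := norm_sub_le_of_mem_cube hr hy
  have h2 : 0 ≤ √n * r := by positivity
  linarith

theorem isCompact_cube (n : ℕ) (c : Rn n) {r : ℝ} (hr : 0 ≤ r) : IsCompact (cube n c r) :=
  (isCompact_closedBall c _).of_isClosed_subset (isClosed_cube n c r)
    (cube_subset_closedBall n c hr)

theorem avg_eq_setAverage (n : ℕ) (b : Rn n → ℝ) (Q : Set (Rn n)) :
    avg n b Q = ⨍ x in Q, b x := by
  rw [avg, setAverage_eq, smul_eq_mul, measureReal_def]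

theorem measureReal_closedBall_Rn (n : ℕ) (c : Rn n) {r : ℝ} (hr : 0 ≤ r) :
    volume.real (closedBall c r) = r ^ n * volume.real (closedBall (0 : Rn n) 1) := by
  have := measureReal_closedBall_mul (volume : Measure (Rn n)) c hr zero_le_one
  rw [mul_one, finrank_euclideanSpace_fin] at this
  rw [this, Measure.addHaar_real_closedBall_center]

theorem osc_le_one_of_bmoNorm_eq_one {n : ℕ} {b : Rn n → ℝ} (hb : bmoNorm n b = 1) (c : Rn n)
    {r : ℝ} (hr : 0 < r) : osc n b (cube n c r) ≤ 1 := by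
  have h : ENNReal.ofReal (osc n b (cube n c r)) ≤ bmoNorm n b :=
    le_iSup₂_of_le (f := fun (c : Rn n) (r : {r : ℝ // 0 < r}) =>
      ENNReal.ofReal (osc n b (cube n c r.1))) c ⟨r, hr⟩ le_rfl
  rw [hb] at h
  exact ENNReal.ofReal_le_one.1 h

theorem setIntegral_cube_osc_le {n : ℕ} {b : Rn n → ℝ} {c : Rn n} {r : ℝ} (hr : 0 < r)
    (hosc : osc n b (cube n c r) ≤ 1) :
    ∫ y in cube n c r, |b y - avg n b (cube n c r)| ≤ r ^ n := by
  rw [osc, volume_cube_toReal n c hr.le, inv_mul_le_iff₀ (by positivity), mul_one] at hosc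
  exact hosc

theorem ballOscLE_of_osc_cube_le_one {n : ℕ} {b : Rn n → ℝ} (hb : LocallyIntegrable b volume)
    (hosc : ∀ c r, 0 < r → osc n b (cube n c r) ≤ 1) :
    BallOscLE volume b (2 * 2 ^ n / volume.real (closedBall (0 : Rn n) 1)) := by
  intro x ρ hρ
  have hω := measureReal_closedBall_pos (volume : Measure (Rn n)) 0 one_pos
  have hpos := measureReal_closedBall_pos (volume : Measure (Rn n)) x hρ
  set a := avg n b (cube n x (2 * ρ))
  have h1 : ∫ y in closedBall x ρ, |b y - a| ≤ (2 * ρ) ^ n :=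
    (setIntegral_mono_set
      ((locallyIntegrable_abs_sub_const hb _).integrableOn_isCompact
        (isCompact_cube n x (by positivity)))
      (ae_of_all _ fun y => abs_nonneg _) (closedBall_subset_cube n x ρ).eventuallyLE).trans
      (setIntegral_cube_osc_le (by positivity) (hosc x _ (by positivity)))
  have h2 := abs_setAverage_sub_le (hb.integrableOn_isCompact (isCompact_closedBall x ρ)) hpos a
  have hint : ∀ a, IntegrableOn (fun y => |b y - a|) (closedBall x ρ) := fun a =>
    (locallyIntegrable_abs_sub_const hb _).integrableOn_isCompact (isCompact_closedBall x ρ)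
  have hconst : IntegrableOn (fun _ : Rn n => |a - ballAvg volume b x ρ|) (closedBall x ρ) :=
    integrableOn_const measure_closedBall_lt_top.ne
  have h3 : volume.real (closedBall x ρ) * |a - ballAvg volume b x ρ| ≤
      ∫ y in closedBall x ρ, |b y - a| := by
    rw [le_div_iff₀ hpos] at h2
    rw [abs_sub_comm, mul_comm]
    exact h2
  calc ∫ y in closedBall x ρ, |b y - ballAvg volume b x ρ|
      ≤ ∫ y in closedBall x ρ, (|b y - a| + |a - ballAvg volume b x ρ|) :=
        integral_mono (hint _) ((hint _).add hconst) fun y => abs_sub_le _ _ _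
    _ = (∫ y in closedBall x ρ, |b y - a|) +
          volume.real (closedBall x ρ) * |a - ballAvg volume b x ρ| := by
        rw [integral_add (hint _) hconst, setIntegral_const, smul_eq_mul]
    _ ≤ 2 * (2 * ρ) ^ n := by linarith
    _ = _ := by
        rw [measureReal_closedBall_Rn n x hρ.le]
        field_simp
        ring

/-- Weighted integrability of powers of a function in the unit ball of `BMO`. -/
theorem exists_integral_weighted_osc_cube_le (n : ℕ) (hn : 1 ≤ n) (N : ℕ) {η : ℝ} (hη : 0 < η) :
    ∃ C : ℝ, 0 < C ∧ ∀ b : Rn n → ℝ, LocallyIntegrable b volume →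
      (∀ c r, 0 < r → osc n b (cube n c r) ≤ 1) → ∀ c r, 0 < r →
      Integrable (fun x => (1 + |b x - avg n b (cube n c r)|) ^ N *
        (1 + ‖x - c‖ / r) ^ (-(n + η))) ∧
      ∫ x, (1 + |b x - avg n b (cube n c r)|) ^ N * (1 + ‖x - c‖ / r) ^ (-(n + η)) ≤
        C * r ^ n := by
  set ω := volume.real (closedBall (0 : Rn n) 1) with hωdef
  have hω : 0 < ω := measureReal_closedBall_pos (volume : Measure (Rn n)) 0 one_pos
  set K : ℝ := 2 * 2 ^ n / ω with hKdef
  have hK0 : 0 < K := by positivity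
  obtain ⟨C, hC0, hC⟩ := exists_lintegral_weighted_osc_le (μ := (volume : Measure (Rn n)))
    K hK0 N hη
  rw [finrank_euclideanSpace_fin] at hC
  set κ : ℝ := K * (√n ^ n * ω) with hκ
  have hκ0 : 0 ≤ κ := by positivity
  have hsq : 1 ≤ √(n : ℝ) := by
    rw [Real.one_le_sqrt]; exact_mod_cast hn
  refine ⟨(1 + κ) ^ N * C * (√n ^ n * ω), by positivity, fun b hb hosc c r hr => ?_⟩
  have hK := ballOscLE_of_osc_cube_le_one hb hosc
  set m := ballAvg volume b c (√n * r)
  set a := avg n b (cube n c r) with ha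
  have hr' : 0 < √n * r := by positivity
  have hvol := measureReal_closedBall_Rn n c hr'.le
  have hma : |m - a| ≤ κ := by
    have hV : volume.real (cube n c r) = r ^ n := volume_cube_toReal n c hr.le
    rw [abs_sub_comm, ha, avg_eq_setAverage]
    refine (abs_setAverage_sub_le (hb.integrableOn_isCompact (isCompact_cube n c hr.le))
      (by rw [hV]; positivity) m).trans ?_
    rw [hV, div_le_iff₀ (by positivity)]
    calc ∫ y in cube n c r, |b y - m| ≤ ∫ y in closedBall c (√n * r), |b y - m| :=
          setIntegral_mono_set
            ((locallyIntegrable_abs_sub_const hb _).integrableOn_isCompact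
              (isCompact_closedBall _ _))
            (ae_of_all _ fun y => abs_nonneg _) (cube_subset_closedBall n c hr.le).eventuallyLE
      _ ≤ K * volume.real (closedBall c (√n * r)) := hK c _ hr'
      _ = _ := by rw [hvol, hκ]; ring
  have hpt : ∀ x, (1 + |b x - a|) ^ N * (1 + ‖x - c‖ / r) ^ (-(n + η)) ≤
      (1 + κ) ^ N * ((1 + |b x - m|) ^ N * (1 + ‖x - c‖ / (√n * r)) ^ (-(n + η))) := by
    intro x
    rw [← mul_assoc, ← mul_pow]
    have h1 : 1 + |b x - a| ≤ (1 + κ) * (1 + |b x - m|) := by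
      have := abs_sub_le (b x) m a
      nlinarith [abs_nonneg (b x - m)]
    have h2 : (1 + ‖x - c‖ / r) ^ (-(n + η)) ≤ (1 + ‖x - c‖ / (√n * r)) ^ (-(n + η)) := by
      refine Real.rpow_le_rpow_of_nonpos (by positivity) ?_ ?_
      · gcongr
        exact le_mul_of_one_le_left hr.le hsq
      · have : (0 : ℝ) ≤ n := Nat.cast_nonneg n
        linarith
    gcongr
  have hlint : ∫⁻ x, ENNReal.ofReal ((1 + |b x - a|) ^ N *
      (1 + ‖x - c‖ / r) ^ (-(n + η))) ≤
      ENNReal.ofReal ((1 + κ) ^ N * C * (√n ^ n * ω) * r ^ n) := by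
    calc _ ≤ ∫⁻ x, ENNReal.ofReal ((1 + κ) ^ N) * ENNReal.ofReal ((1 + |b x - m|) ^ N *
          (1 + ‖x - c‖ / (√n * r)) ^ (-(n + η))) := by
          refine lintegral_mono fun x => ?_
          rw [← ENNReal.ofReal_mul (by positivity)]
          exact ENNReal.ofReal_le_ofReal (hpt x)
      _ ≤ ENNReal.ofReal ((1 + κ) ^ N) *
          (ENNReal.ofReal C * volume (closedBall c (√n * r))) := by
          rw [lintegral_const_mul' _ _ ENNReal.ofReal_ne_top]
          gcongr
          exact hC b hb hK c _ hr'
      _ = _ := by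
          rw [← ENNReal.ofReal_toReal
            (measure_closedBall_lt_top (μ := volume) (x := c) (r := √n * r)).ne,
            ← measureReal_def, hvol, ← ENNReal.ofReal_mul hC0.le,
            ← ENNReal.ofReal_mul (by positivity)]
          congr 1
          ring
  have hmeas : AEStronglyMeasurable (fun x => (1 + |b x - a|) ^ N *
      (1 + ‖x - c‖ / r) ^ (-(n + η))) volume := by
    have h1 : AEMeasurable b volume := hb.aestronglyMeasurable.aemeasurable
    have h2 : Measurable fun x : Rn n => (1 + ‖x - c‖ / r) ^ (-(n + η)) := by fun_prop
    exact ((((h1.sub_const a).abs.const_add 1).pow_const N).mul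
      h2.aemeasurable).aestronglyMeasurable
  have hnn : ∀ x, 0 ≤ (1 + |b x - a|) ^ N * (1 + ‖x - c‖ / r) ^ (-(n + η)) := fun x => by
    positivity
  refine ⟨⟨hmeas, ?_⟩, ?_⟩
  · rw [hasFiniteIntegral_iff_ofReal (ae_of_all _ hnn)]
    exact hlint.trans_lt ENNReal.ofReal_lt_top
  · rw [integral_eq_lintegral_of_nonneg_ae (ae_of_all _ hnn) hmeas]
    exact ENNReal.toReal_le_of_le_ofReal (by positivity) hlint

end Cubes

section BilinearKernel

theorem abs_rpow_neg_sub_rpow_neg_le {κ m A B : ℝ} (hκ : 0 ≤ κ) (hm : 0 < m) (hA : m ≤ A)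
    (hB : m ≤ B) : |A ^ (-κ) - B ^ (-κ)| ≤ κ * m ^ (-κ - 1) * |A - B| := by
  have h := (convex_Ici m).norm_image_sub_le_of_norm_hasDerivWithin_le (𝕜 := ℝ)
    (f := fun t : ℝ => t ^ (-κ)) (f' := fun t => -κ * t ^ (-κ - 1)) (C := κ * m ^ (-κ - 1))
    (x := B) (y := A) (fun t ht => by
      have ht0 : 0 < t := hm.trans_le ht
      exact (Real.hasDerivAt_rpow_const (Or.inl ht0.ne')).hasDerivWithinAt)
    (fun t ht => by
      have ht0 : 0 < t := hm.trans_le ht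
      rw [norm_mul, norm_neg, Real.norm_of_nonneg hκ, Real.norm_of_nonneg (by positivity)]
      refine mul_le_mul_of_nonneg_left ?_ hκ
      exact Real.rpow_le_rpow_of_nonpos hm ht (by linarith)) hB hA
  simpa only [Real.norm_eq_abs] using h

/-- Main term and error term of a bilinear form with a slowly varying kernel, tested against
a mean-zero function. -/
theorem bilinear_form_bounds {Y : Type*} [MeasurableSpace Y] {ν : Measure Y} [IsFiniteMeasure ν]
    {g s k₁ k₂ : Y → ℝ} {k : Y × Y → ℝ} {w e lo hi Λ : ℝ} (hg : Integrable g ν)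
    (hs : AEStronglyMeasurable s ν) (hs2 : ∀ y, |s y| ≤ 2) (hs0 : ∫ y, s y ∂ν = 0)
    (hgs : ∀ y, 0 ≤ g y * s y) (hgV : ∫ y, |g y| ∂ν ≤ ν.real Set.univ) (he : 0 ≤ e)
    (hgse : ν.real Set.univ * e ≤ ∫ y, g y * s y ∂ν)
    (hk : Measurable k) (hk₁ : Measurable k₁) (hk₂ : Measurable k₂)
    (hlo : 0 ≤ lo) (hhi : 0 ≤ hi) (hΛ : 0 ≤ Λ)
    (hklo : ∀ᵐ z ∂ν.prod ν, lo ≤ k z) (hkhi : ∀ᵐ z ∂ν.prod ν, |k z| ≤ hi)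
    (hk₁hi : ∀ᵐ y ∂ν, |k₁ y| ≤ hi) (hk₂hi : ∀ᵐ y ∂ν, |k₂ y| ≤ hi)
    (hd₁ : ∀ᵐ z ∂ν.prod ν, |k z - k₁ z.1| ≤ Λ) (hd₂ : ∀ᵐ z ∂ν.prod ν, |k z - k₂ z.2| ≤ Λ) :
    |∫ y₁, ∫ y₂, (w - g y₁) * (w - g y₂) * s y₁ * s y₂ * k (y₁, y₂) ∂ν ∂ν| ≤
        4 * hi * (ν.real Set.univ * (1 + |w|)) ^ 2 ∧
    ∃ T, lo * (ν.real Set.univ * e) ^ 2 ≤ T ∧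
      |(∫ y₁, ∫ y₂, (w - g y₁) * (w - g y₂) * s y₁ * s y₂ * k (y₁, y₂) ∂ν ∂ν) - T| ≤
        4 * Λ * (ν.real Set.univ * (1 + |w|)) ^ 2 := by
  set V := ν.real Set.univ with hV
  have hV0 : 0 ≤ V := measureReal_nonneg
  have hgm := hg.aestronglyMeasurable
  have hsint : Integrable s ν := (integrable_const (2 : ℝ)).mono' hs
    (ae_of_all _ fun y => by simpa using hs2 y)
  have hwg : Integrable (fun y => |w| + |g y|) ν := (integrable_const _).add hg.abs
  have hwgV : ∫ y, (|w| + |g y|) ∂ν ≤ V * (1 + |w|) := by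
    rw [integral_add (integrable_const _) hg.abs, integral_const, smul_eq_mul]
    linarith
  have hwg0 : 0 ≤ ∫ y, (|w| + |g y|) ∂ν := integral_nonneg fun y => by positivity
  have hdom : Integrable (fun z : Y × Y => 4 * hi * ((|w| + |g z.1|) * (|w| + |g z.2|)))
      (ν.prod ν) := (hwg.mul_prod hwg).const_mul _
  have hg1 : AEStronglyMeasurable (fun z : Y × Y => g z.1) (ν.prod ν) := hgm.comp_fst
  have hg2 : AEStronglyMeasurable (fun z : Y × Y => g z.2) (ν.prod ν) := hgm.comp_snd
  have hs1 : AEStronglyMeasurable (fun z : Y × Y => s z.1) (ν.prod ν) := hs.comp_fst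
  have hs2' : AEStronglyMeasurable (fun z : Y × Y => s z.2) (ν.prod ν) := hs.comp_snd
  have hkm : AEStronglyMeasurable k (ν.prod ν) := hk.aestronglyMeasurable
  set J : Y × Y → ℝ := fun z => (w - g z.1) * (w - g z.2) * s z.1 * s z.2 * k z with hJ
  set D : Y × Y → ℝ := fun z => g z.1 * g z.2 * s z.1 * s z.2 * k z with hD
  set P₁ : Y × Y → ℝ := fun z => (w * (w - g z.1) * s z.1 * k₁ z.1) * s z.2 with hP₁
  set P₂ : Y × Y → ℝ := fun z => s z.1 * (w * g z.2 * s z.2 * k₂ z.2) with hP₂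
  have hss : ∀ z : Y × Y, |s z.1| * |s z.2| ≤ 4 := fun z => by
    have := mul_le_mul (hs2 z.1) (hs2 z.2) (abs_nonneg _) (by norm_num)
    linarith
  have hJb : ∀ᵐ z ∂ν.prod ν, ‖J z‖ ≤ 4 * hi * ((|w| + |g z.1|) * (|w| + |g z.2|)) := by
    filter_upwards [hkhi] with z hz
    simp only [hJ, Real.norm_eq_abs, abs_mul]
    calc |w - g z.1| * |w - g z.2| * |s z.1| * |s z.2| * |k z|
        = (|w - g z.1| * |w - g z.2|) * (|s z.1| * |s z.2|) * |k z| := by ring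
      _ ≤ ((|w| + |g z.1|) * (|w| + |g z.2|)) * 4 * hi := by
          gcongr
          · exact abs_sub _ _
          · exact abs_sub _ _
          · exact hss z
      _ = _ := by ring
  have hJi : Integrable J (ν.prod ν) := by
    refine hdom.mono' ?_ hJb
    exact ((((aestronglyMeasurable_const.sub hg1).mul (aestronglyMeasurable_const.sub hg2)).mul
      hs1).mul hs2').mul hkm
  have hDi : Integrable D (ν.prod ν) := by
    refine hdom.mono' ((((hg1.mul hg2).mul hs1).mul hs2').mul hkm) ?_
    filter_upwards [hkhi] with z hz
    simp only [hD, Real.norm_eq_abs, abs_mul]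
    calc |g z.1| * |g z.2| * |s z.1| * |s z.2| * |k z|
        = (|g z.1| * |g z.2|) * (|s z.1| * |s z.2|) * |k z| := by ring
      _ ≤ ((|w| + |g z.1|) * (|w| + |g z.2|)) * 4 * hi := by
          gcongr
          · linarith [abs_nonneg w]
          · linarith [abs_nonneg w]
          · exact hss z
      _ = _ := by ring
  have hP₁i : Integrable P₁ (ν.prod ν) := by
    refine Integrable.mul_prod (f := fun y => w * (w - g y) * s y * k₁ y) ?_ hsint
    refine (((integrable_const w).sub hg).const_mul w).mul_bdd (c := 2 * hi)
      (g := fun y => s y * k₁ y) (hs.mul hk₁.aestronglyMeasurable) ?_ |>.congr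
      (ae_of_all _ fun y => by simp only [Pi.sub_apply]; ring)
    filter_upwards [hk₁hi] with y hy
    rw [norm_mul]
    exact mul_le_mul (hs2 y) hy (norm_nonneg _) (by norm_num)
  have hP₂i : Integrable P₂ (ν.prod ν) := by
    refine Integrable.mul_prod (g := fun y => w * g y * s y * k₂ y) hsint ?_
    refine (hg.const_mul w).mul_bdd (c := 2 * hi)
      (g := fun y => s y * k₂ y) (hs.mul hk₂.aestronglyMeasurable) ?_ |>.congr
      (ae_of_all _ fun y => by ring)
    filter_upwards [hk₂hi] with y hy
    rw [norm_mul]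
    exact mul_le_mul (hs2 y) hy (norm_nonneg _) (by norm_num)
  have hP₁0 : ∫ z, P₁ z ∂ν.prod ν = 0 := by
    rw [hP₁, integral_prod_mul (fun y => w * (w - g y) * s y * k₁ y) s, hs0, mul_zero]
  have hP₂0 : ∫ z, P₂ z ∂ν.prod ν = 0 := by
    rw [hP₂, integral_prod_mul s (fun y => w * g y * s y * k₂ y), hs0, zero_mul]
  have hiter : ∫ y₁, ∫ y₂, (w - g y₁) * (w - g y₂) * s y₁ * s y₂ * k (y₁, y₂) ∂ν ∂ν =
      ∫ z, J z ∂ν.prod ν := (integral_prod J hJi).symm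
  rw [hiter]
  refine ⟨?_, ∫ z, D z ∂ν.prod ν, ?_, ?_⟩
  · calc |∫ z, J z ∂ν.prod ν| ≤ ∫ z, 4 * hi * ((|w| + |g z.1|) * (|w| + |g z.2|)) ∂ν.prod ν :=
          norm_integral_le_of_norm_le hdom hJb
      _ = 4 * hi * (∫ y, (|w| + |g y|) ∂ν) ^ 2 := by
          rw [integral_const_mul,
            integral_prod_mul (fun y => |w| + |g y|) (fun y => |w| + |g y|), sq]
      _ ≤ _ := by gcongr
  · have hgsi : Integrable (fun y => g y * s y) ν :=
      hg.mul_bdd hs (ae_of_all _ hs2)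
    calc lo * (V * e) ^ 2 ≤ lo * (∫ y, g y * s y ∂ν) ^ 2 := by gcongr
      _ = ∫ z, lo * ((g z.1 * s z.1) * (g z.2 * s z.2)) ∂ν.prod ν := by
          rw [integral_const_mul,
            integral_prod_mul (fun y => g y * s y) (fun y => g y * s y), sq]
      _ ≤ ∫ z, D z ∂ν.prod ν := by
          refine integral_mono_ae ((hgsi.mul_prod hgsi).const_mul _) hDi ?_
          filter_upwards [hklo] with z hz
          have h1 := mul_nonneg (hgs z.1) (hgs z.2)
          calc lo * ((g z.1 * s z.1) * (g z.2 * s z.2)) ≤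
                k z * ((g z.1 * s z.1) * (g z.2 * s z.2)) := by gcongr
            _ = D z := by simp only [hD]; ring
  · have hErr : (∫ z, J z ∂ν.prod ν) - ∫ z, D z ∂ν.prod ν =
        ∫ z, (J z - P₁ z + P₂ z - D z) ∂ν.prod ν := by
      rw [integral_sub (f := fun z => J z - P₁ z + P₂ z) ((hJi.sub hP₁i).add hP₂i) hDi,
        integral_add (f := fun z => J z - P₁ z) (hJi.sub hP₁i) hP₂i,
        integral_sub hJi hP₁i, hP₁0, hP₂0, sub_zero, add_zero]
    have hbi : Integrable (fun z : Y × Y => 4 * Λ * |w| * ((|w| + |g z.1|) * 1 + 1 * |g z.2|))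
        (ν.prod ν) := ((hwg.mul_prod (integrable_const 1)).add
          ((integrable_const 1).mul_prod hg.abs)).const_mul _
    rw [hErr, ← Real.norm_eq_abs]
    calc ‖∫ z, (J z - P₁ z + P₂ z - D z) ∂ν.prod ν‖
        ≤ ∫ z, 4 * Λ * |w| * ((|w| + |g z.1|) * 1 + 1 * |g z.2|) ∂ν.prod ν := by
          refine norm_integral_le_of_norm_le hbi ?_
          filter_upwards [hd₁, hd₂] with z h1 h2
          have heq : J z - P₁ z + P₂ z - D z = w * ((w - g z.1) * (s z.1 * s z.2) *
              (k z - k₁ z.1)) - w * (g z.2 * (s z.1 * s z.2) * (k z - k₂ z.2)) := by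
            simp only [hJ, hP₁, hP₂, hD]; ring
          rw [heq]
          refine (norm_sub_le _ _).trans ?_
          simp only [Real.norm_eq_abs, abs_mul]
          have hss' := hss z
          calc |w| * (|w - g z.1| * (|s z.1| * |s z.2|) * |k z - k₁ z.1|) +
                |w| * (|g z.2| * (|s z.1| * |s z.2|) * |k z - k₂ z.2|)
              ≤ |w| * ((|w| + |g z.1|) * 4 * Λ) + |w| * (|g z.2| * 4 * Λ) := by
                gcongr
                exact abs_sub _ _
            _ = _ := by ring
      _ = 4 * Λ * |w| * ((∫ y, (|w| + |g y|) ∂ν) * V + V * ∫ y, |g y| ∂ν) := by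
          rw [integral_const_mul, integral_add (hwg.mul_prod (integrable_const 1))
            ((integrable_const 1).mul_prod hg.abs),
            integral_prod_mul (fun y => |w| + |g y|) (fun _ => (1 : ℝ)),
            integral_prod_mul (fun _ => (1 : ℝ)) (fun y => |g y|)]
          simp [hV]
      _ ≤ 4 * Λ * |w| * ((V * (1 + |w|)) * V + V * V) := by gcongr
      _ = 4 * Λ * V ^ 2 * (|w| * (2 + |w|)) := by ring
      _ ≤ 4 * Λ * V ^ 2 * (1 + |w|) ^ 2 := by
          gcongr
          nlinarith [abs_nonneg w]
      _ = _ := by ring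

end BilinearKernel

section Commutator

theorem measurable_sign : Measurable Real.sign := by
  unfold Real.sign
  exact Measurable.ite measurableSet_Iio measurable_const
    (Measurable.ite measurableSet_Ioi measurable_const measurable_const)

theorem abs_sign_le_one (t : ℝ) : |Real.sign t| ≤ 1 := by
  rcases Real.sign_apply_eq t with h | h | h <;> simp [h]

theorem mul_sign_eq_abs (t : ℝ) : t * Real.sign t = |t| := by
  rcases lt_trichotomy t 0 with h | h | h
  · rw [Real.sign_of_neg h, abs_of_neg h]; ring
  · simp [h]
  · rw [Real.sign_of_pos h, abs_of_pos h, mul_one]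

/-- The mean-zero sign function `sgn (b - b_Q) - c₀` of `b` on `Q`. -/
def signFn (n : ℕ) (b : Rn n → ℝ) (Q : Set (Rn n)) (y : Rn n) : ℝ :=
  Real.sign (b y - avg n b Q) -
    (volume Q).toReal⁻¹ * ∫ z in Q, Real.sign (b z - avg n b Q)

/-- The normalized test function attached to `b` and `Q`. -/
def testFn (n : ℕ) (b : Rn n → ℝ) (Q : Set (Rn n)) (p : ℝ) : Rn n → ℝ :=
  Q.indicator fun y => (volume Q).toReal ^ (-(1 / p)) * signFn n b Q y

theorem aestronglyMeasurable_signFn {n : ℕ} {b : Rn n → ℝ} (hb : LocallyIntegrable b volume)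
    (Q : Set (Rn n)) : AEStronglyMeasurable (signFn n b Q) volume :=
  ((measurable_sign.comp_aemeasurable
    ((hb.aestronglyMeasurable.aemeasurable).sub_const _)).sub_const _).aestronglyMeasurable

theorem abs_signMean_le_one {n : ℕ} {b : Rn n → ℝ} {Q : Set (Rn n)} (hQ : 0 < (volume Q).toReal) :
    |(volume Q).toReal⁻¹ * ∫ z in Q, Real.sign (b z - avg n b Q)| ≤ 1 := by
  have hfin : volume Q < ∞ := by
    rw [lt_top_iff_ne_top]; intro h; simp [h] at hQ
  have h := norm_setIntegral_le_of_norm_le_const (μ := volume) (s := Q)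
    (f := fun z => Real.sign (b z - avg n b Q)) hfin (fun z _ => abs_sign_le_one _)
  rw [abs_mul, abs_of_pos (inv_pos.2 hQ), inv_mul_le_iff₀ hQ, mul_one]
  simpa [measureReal_def] using h

theorem abs_signFn_le_two {n : ℕ} {b : Rn n → ℝ} {Q : Set (Rn n)} (hQ : 0 < (volume Q).toReal)
    (y : Rn n) : |signFn n b Q y| ≤ 2 := by
  refine (abs_sub _ _).trans ?_
  have := abs_signMean_le_one (b := b) hQ
  have := abs_sign_le_one (b y - avg n b Q)
  linarith

theorem integrableOn_sign {n : ℕ} {b : Rn n → ℝ} (hb : LocallyIntegrable b volume)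
    {Q : Set (Rn n)} (hfin : volume Q ≠ ∞) (a : ℝ) :
    IntegrableOn (fun y => Real.sign (b y - a)) Q := by
  refine (integrableOn_const (C := (1 : ℝ)) hfin).mono' ?_ (ae_of_all _ fun y => abs_sign_le_one _)
  exact ((measurable_sign.comp_aemeasurable
    ((hb.aestronglyMeasurable.aemeasurable).sub_const a)).aestronglyMeasurable).restrict

theorem setIntegral_signFn {n : ℕ} {b : Rn n → ℝ} (hb : LocallyIntegrable b volume)
    {Q : Set (Rn n)} (hQ : 0 < (volume Q).toReal) : ∫ y in Q, signFn n b Q y = 0 := by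
  have hfin : volume Q ≠ ∞ := by
    intro h; simp [h] at hQ
  unfold signFn
  rw [integral_sub (integrableOn_sign hb hfin _) (integrableOn_const hfin), setIntegral_const,
    measureReal_def, smul_eq_mul, mul_inv_cancel_left₀ hQ.ne', sub_self]

theorem mul_signFn_nonneg {n : ℕ} {b : Rn n → ℝ} {Q : Set (Rn n)} (hQ : 0 < (volume Q).toReal)
    (y : Rn n) : 0 ≤ (b y - avg n b Q) * signFn n b Q y := by
  rw [signFn, mul_sub, mul_sign_eq_abs, sub_nonneg]
  refine (le_abs_self _).trans ?_
  rw [abs_mul]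
  exact mul_le_of_le_one_right (abs_nonneg _) (abs_signMean_le_one hQ)

theorem setIntegral_mul_signFn {n : ℕ} {b : Rn n → ℝ} {Q : Set (Rn n)}
    (hbQ : IntegrableOn b Q) (hQ : 0 < (volume Q).toReal) :
    ∫ y in Q, (b y - avg n b Q) * signFn n b Q y = (volume Q).toReal * osc n b Q := by
  have hfin : volume Q ≠ ∞ := by
    intro h; simp [h] at hQ
  have hg : IntegrableOn (fun y => b y - avg n b Q) Q := hbQ.sub (integrableOn_const hfin)
  simp only [signFn, mul_sub, mul_sign_eq_abs]
  rw [integral_sub hg.abs (hg.mul_const _), integral_mul_const,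
    integral_sub hbQ (integrableOn_const hfin), setIntegral_const, osc, measureReal_def,
    mul_inv_cancel_left₀ hQ.ne', smul_eq_mul]
  have : (volume Q).toReal * avg n b Q = ∫ y in Q, b y := by
    rw [avg, mul_inv_cancel_left₀ hQ.ne']
  rw [this]; ring

theorem commI_testFn_eq {n : ℕ} {α : ℝ} {b : Rn n → ℝ} {Q : Set (Rn n)} (hQm : MeasurableSet Q)
    (p₁ p₂ : ℝ) (x : Rn n) :
    commI n α b (testFn n b Q p₁) (testFn n b Q p₂) x =
      ((volume Q).toReal ^ (-(1 / p₁)) * (volume Q).toReal ^ (-(1 / p₂))) *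
      ∫ y₁ in Q, ∫ y₂ in Q, ((b x - avg n b Q) - (b y₁ - avg n b Q)) *
        ((b x - avg n b Q) - (b y₂ - avg n b Q)) * signFn n b Q y₁ * signFn n b Q y₂ *
        (‖x - y₁‖ ^ 2 + ‖x - y₂‖ ^ 2) ^ (α / 2 - n) := by
  rw [commI, ← integral_const_mul, ← integral_indicator hQm]
  congr 1
  funext y₁
  by_cases hy₁ : y₁ ∈ Q
  · rw [Set.indicator_of_mem hy₁, ← integral_const_mul, ← integral_indicator hQm]
    congr 1
    funext y₂
    by_cases hy₂ : y₂ ∈ Q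
    · rw [Set.indicator_of_mem hy₂, testFn, testFn, Set.indicator_of_mem hy₁,
        Set.indicator_of_mem hy₂]
      ring
    · rw [Set.indicator_of_notMem hy₂, testFn, testFn, Set.indicator_of_notMem hy₂]
      ring
  · rw [Set.indicator_of_notMem hy₁, testFn, Set.indicator_of_notMem hy₁]
    simp

theorem aestronglyMeasurable_commI {n : ℕ} {α : ℝ} {b f₁ f₂ : Rn n → ℝ}
    (hb : AEStronglyMeasurable b volume) (hf₁ : AEStronglyMeasurable f₁ volume)
    (hf₂ : AEStronglyMeasurable f₂ volume) :
    AEStronglyMeasurable (commI n α b f₁ f₂) volume := by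
  have hker : Measurable fun z : (Rn n × Rn n) × Rn n =>
      (‖z.1.1 - z.1.2‖ ^ 2 + ‖z.1.1 - z.2‖ ^ 2) ^ (α / 2 - n) := by fun_prop
  have hbx : AEStronglyMeasurable (fun z : (Rn n × Rn n) × Rn n => b z.1.1)
      ((volume.prod volume).prod volume) :=
    (hb.comp_fst (ν := (volume : Measure (Rn n)))).comp_fst
  have h1 : ∀ f : Rn n → ℝ, AEStronglyMeasurable f volume → AEStronglyMeasurable
      (fun z : (Rn n × Rn n) × Rn n => f z.1.2) ((volume.prod volume).prod volume) := fun f hf =>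
    (hf.comp_snd (μ := (volume : Measure (Rn n)))).comp_fst
  have h2 : ∀ f : Rn n → ℝ, AEStronglyMeasurable f volume → AEStronglyMeasurable
      (fun z : (Rn n × Rn n) × Rn n => f z.2)
      (((volume : Measure (Rn n)).prod volume).prod volume) := fun f hf => hf.comp_snd
  have hF : AEStronglyMeasurable (fun z : (Rn n × Rn n) × Rn n =>
      (b z.1.1 - b z.1.2) * (b z.1.1 - b z.2) * f₁ z.1.2 * f₂ z.2 *
        (‖z.1.1 - z.1.2‖ ^ 2 + ‖z.1.1 - z.2‖ ^ 2) ^ (α / 2 - n))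
      ((volume.prod volume).prod volume) :=
    ((((hbx.sub (h1 b hb)).mul (hbx.sub (h2 b hb))).mul (h1 f₁ hf₁)).mul (h2 f₂ hf₂)).mul
      hker.aestronglyMeasurable
  exact hF.integral_prod_right'.integral_prod_right'

theorem aestronglyMeasurable_testFn {n : ℕ} {b : Rn n → ℝ} (hb : LocallyIntegrable b volume)
    {Q : Set (Rn n)} (hQm : MeasurableSet Q) (p : ℝ) :
    AEStronglyMeasurable (testFn n b Q p) volume :=
  ((aestronglyMeasurable_signFn hb Q).const_mul _).indicator hQm

/-- Size and regularity of the kernel `(‖x - y₁‖² + ‖x - y₂‖²)^(-κ)` far from the cube. -/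
theorem kernel_bounds {F : Type*} [NormedAddCommGroup F] {κ X δ : ℝ} (hκ : 0 ≤ κ)
    {x c y₁ y₂ y₂' : F} (hX : ‖x - c‖ = X) (hX0 : 0 < X) (hδ : 4 * δ ≤ X)
    (h₁ : ‖y₁ - c‖ ≤ δ) (h₂ : ‖y₂ - c‖ ≤ δ) (h₂' : ‖y₂' - c‖ ≤ δ) :
    (4 : ℝ) ^ (-κ) * X ^ (-(2 * κ)) ≤ (‖x - y₁‖ ^ 2 + ‖x - y₂‖ ^ 2) ^ (-κ) ∧
    (‖x - y₁‖ ^ 2 + ‖x - y₂‖ ^ 2) ^ (-κ) ≤ X ^ (-(2 * κ)) ∧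
    |(‖x - y₁‖ ^ 2 + ‖x - y₂‖ ^ 2) ^ (-κ) - (‖x - y₁‖ ^ 2 + ‖x - y₂'‖ ^ 2) ^ (-κ)| ≤
      8 * κ * δ * X ^ (-(2 * κ) - 1) := by
  have hb : ∀ y : F, ‖y - c‖ ≤ δ → X - δ ≤ ‖x - y‖ ∧ ‖x - y‖ ≤ X + δ := by
    intro y hy
    have h1 := norm_sub_le_norm_sub_add_norm_sub x c y
    have h2 := norm_sub_le_norm_sub_add_norm_sub x y c
    rw [norm_sub_rev c y] at h1
    constructor <;> linarith
  obtain ⟨l1, u1⟩ := hb y₁ h₁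
  obtain ⟨l2, u2⟩ := hb y₂ h₂
  obtain ⟨l3, u3⟩ := hb y₂' h₂'
  have hsq : ∀ t : ℝ, X - δ ≤ t → t ≤ X + δ → X ^ 2 / 2 ≤ t ^ 2 ∧ t ^ 2 ≤ 2 * X ^ 2 := by
    intro t h1 h2
    constructor <;> nlinarith
  obtain ⟨l1', u1'⟩ := hsq _ l1 u1
  obtain ⟨l2', u2'⟩ := hsq _ l2 u2
  obtain ⟨l3', u3'⟩ := hsq _ l3 u3
  have hXX : (X ^ 2 : ℝ) ^ (-κ) = X ^ (-(2 * κ)) := by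
    rw [← Real.rpow_natCast, ← Real.rpow_mul hX0.le]; congr 1; push_cast; ring
  have hX2 : 0 < X ^ 2 := by positivity
  have hA : X ^ 2 ≤ ‖x - y₁‖ ^ 2 + ‖x - y₂‖ ^ 2 := by linarith
  have hB : X ^ 2 ≤ ‖x - y₁‖ ^ 2 + ‖x - y₂'‖ ^ 2 := by linarith
  refine ⟨?_, ?_, ?_⟩
  · rw [← hXX, ← Real.mul_rpow (by norm_num) hX2.le]
    exact Real.rpow_le_rpow_of_nonpos (by linarith) (by linarith) (by linarith)
  · rw [← hXX]
    exact Real.rpow_le_rpow_of_nonpos hX2 hA (by linarith)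
  · refine (abs_rpow_neg_sub_rpow_neg_le hκ hX2 hA hB).trans ?_
    have hdiff : |‖x - y₁‖ ^ 2 + ‖x - y₂‖ ^ 2 - (‖x - y₁‖ ^ 2 + ‖x - y₂'‖ ^ 2)| ≤
        8 * δ * X := by
      have h1 : |‖x - y₂‖ - ‖x - y₂'‖| ≤ 2 * δ := by
        rw [abs_le]; constructor <;> linarith
      have h2 : ‖x - y₁‖ ^ 2 + ‖x - y₂‖ ^ 2 - (‖x - y₁‖ ^ 2 + ‖x - y₂'‖ ^ 2) =
          (‖x - y₂‖ - ‖x - y₂'‖) * (‖x - y₂‖ + ‖x - y₂'‖) := by ring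
      have hδ0 : 0 ≤ δ := (norm_nonneg _).trans h₁
      rw [h2, abs_mul, abs_of_nonneg (a := ‖x - y₂‖ + ‖x - y₂'‖) (by positivity)]
      calc _ ≤ (2 * δ) * (4 * X) := by gcongr; linarith
        _ = _ := by ring
    have hpow : (X ^ 2 : ℝ) ^ (-κ - 1) * X = X ^ (-(2 * κ) - 1) := by
      rw [← Real.rpow_natCast, ← Real.rpow_mul hX0.le]
      nth_rewrite 2 [← Real.rpow_one X]
      rw [← Real.rpow_add hX0]; congr 1; push_cast; ring
    calc _ ≤ κ * (X ^ 2) ^ (-κ - 1) * (8 * δ * X) := by gcongr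
      _ = 8 * κ * δ * ((X ^ 2) ^ (-κ - 1) * X) := by ring
      _ = _ := by rw [hpow]

end Commutator

section Pointwise

theorem scaling_identity {n : ℕ} (hn : 1 ≤ n) {α p₁ p₂ q r ρ : ℝ}
    (hq : 1 / q = 1 / p₁ + 1 / p₂ - α / n) (hr : 0 < r) (hρ : 0 < ρ) :
    ((r ^ n) ^ (-(1 / p₁)) * (r ^ n) ^ (-(1 / p₂))) * (r ^ n) ^ 2 * (ρ * r) ^ (-(2 * n - α)) =
      (r ^ n) ^ (-(1 / q)) * ρ ^ (-(2 * n - α)) := by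
  have hn0 : (n : ℝ) ≠ 0 := by positivity
  rw [Real.mul_rpow hρ.le hr.le, ← pow_mul]
  simp only [← Real.rpow_natCast, ← Real.rpow_mul hr.le]
  rw [← Real.rpow_add hr, ← Real.rpow_add hr, mul_comm (ρ ^ _), ← mul_assoc, ← Real.rpow_add hr]
  congr 2
  rw [hq]
  push_cast
  field_simp
  ring

theorem commI_testFn_bounds {n : ℕ} (hn : 1 ≤ n) {α p₁ p₂ q : ℝ} (hαn : α < 2 * n)
    (hq : 1 / q = 1 / p₁ + 1 / p₂ - α / n) {b : Rn n → ℝ} (hb : LocallyIntegrable b volume)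
    {c : Rn n} {r : ℝ} (hr : 0 < r) (hosc : osc n b (cube n c r) ≤ 1) {e : ℝ} (he : 0 ≤ e)
    (hosc' : e ≤ osc n b (cube n c r)) {x : Rn n} (hx : 2 * √n ≤ ‖x - c‖ / r) :
    |commI n α b (testFn n b (cube n c r) p₁) (testFn n b (cube n c r) p₂) x| ≤
      4 * (1 + |b x - avg n b (cube n c r)|) ^ 2 *
        ((r ^ n) ^ (-(1 / q)) * (‖x - c‖ / r) ^ (-(2 * n - α))) ∧
    ∃ T, 4 ^ (-(n - α / 2)) * e ^ 2 *
        ((r ^ n) ^ (-(1 / q)) * (‖x - c‖ / r) ^ (-(2 * n - α))) ≤ T ∧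
      |commI n α b (testFn n b (cube n c r) p₁) (testFn n b (cube n c r) p₂) x - T| ≤
        16 * √n * (n - α / 2) * (1 + |b x - avg n b (cube n c r)|) ^ 2 *
          ((r ^ n) ^ (-(1 / q)) * (‖x - c‖ / r) ^ (-(2 * n - α) - 1)) := by
  set Q := cube n c r with hQ
  set ρ := ‖x - c‖ / r with hρ
  set κ : ℝ := n - α / 2 with hκ
  have hκ0 : 0 ≤ κ := by rw [hκ]; linarith
  have hn0 : 0 < √(n : ℝ) := Real.sqrt_pos.2 (by positivity)
  have hρ0 : 0 < ρ := by linarith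
  have hX : ‖x - c‖ = ρ * r := by rw [hρ]; field_simp
  have hX0 : 0 < ρ * r := by positivity
  have hQm : MeasurableSet Q := measurableSet_cube n c r
  have hVol : (volume Q).toReal = r ^ n := volume_cube_toReal n c hr.le
  have hQ0 : 0 < (volume Q).toReal := by rw [hVol]; positivity
  have hQfin : volume Q ≠ ∞ := by intro h; simp [h] at hQ0
  have : IsFiniteMeasure (volume.restrict Q) := isFiniteMeasure_restrict.2 hQfin
  have hV : (volume.restrict Q).real Set.univ = r ^ n := by
    rw [measureReal_def, Measure.restrict_apply_univ, hVol]
  have hbQ : IntegrableOn b Q := hb.integrableOn_isCompact (isCompact_cube n c hr.le)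
  have hδ : 4 * (√n * r / 2) ≤ ρ * r := by nlinarith
  have hnear : ∀ y ∈ Q, ‖y - c‖ ≤ √n * r / 2 := fun y hy => norm_sub_le_of_mem_cube hr.le hy
  have hcc : ‖c - c‖ ≤ √n * r / 2 := by simp; positivity
  have hker := fun (y₁ y₂ y₂' : Rn n) => kernel_bounds (F := Rn n) hκ0 hX hX0 hδ
    (y₁ := y₁) (y₂ := y₂) (y₂' := y₂')
  have haeQ : ∀ᵐ y ∂volume.restrict Q, y ∈ Q := ae_restrict_mem hQm
  have haeQQ : ∀ᵐ z ∂(volume.restrict Q).prod (volume.restrict Q), z.1 ∈ Q ∧ z.2 ∈ Q := by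
    rw [Measure.prod_restrict]
    exact (ae_restrict_mem (hQm.prod hQm))
  have hnn : ∀ y₁ y₂ : Rn n, 0 ≤ (‖x - y₁‖ ^ 2 + ‖x - y₂‖ ^ 2) ^ (-κ) := fun _ _ => by positivity
  obtain ⟨hA, T, hT, hTd⟩ := bilinear_form_bounds (ν := volume.restrict Q)
    (g := fun y => b y - avg n b Q) (s := signFn n b Q)
    (k₁ := fun y => (‖x - y‖ ^ 2 + ‖x - c‖ ^ 2) ^ (-κ))
    (k₂ := fun y => (‖x - c‖ ^ 2 + ‖x - y‖ ^ 2) ^ (-κ))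
    (k := fun z => (‖x - z.1‖ ^ 2 + ‖x - z.2‖ ^ 2) ^ (-κ))
    (w := b x - avg n b Q) (e := e)
    (lo := 4 ^ (-κ) * (ρ * r) ^ (-(2 * κ))) (hi := (ρ * r) ^ (-(2 * κ)))
    (Λ := 8 * κ * (√n * r / 2) * (ρ * r) ^ (-(2 * κ) - 1))
    (hbQ.sub (integrableOn_const hQfin))
    (aestronglyMeasurable_signFn hb Q).restrict (abs_signFn_le_two hQ0)
    (setIntegral_signFn hb hQ0) (mul_signFn_nonneg hQ0)
    (by rw [hV]; exact setIntegral_cube_osc_le hr hosc) he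
    (by rw [setIntegral_mul_signFn hbQ hQ0, hV, hVol]; gcongr)
    (by fun_prop) (by fun_prop) (by fun_prop) (by positivity) (by positivity) (by positivity)
    (by filter_upwards [haeQQ] with z hz
        exact (hker z.1 z.2 c (hnear _ hz.1) (hnear _ hz.2) hcc).1)
    (by filter_upwards [haeQQ] with z hz
        rw [abs_of_nonneg (hnn _ _)]
        exact (hker z.1 z.2 c (hnear _ hz.1) (hnear _ hz.2) hcc).2.1)
    (by filter_upwards [haeQ] with y hy
        rw [abs_of_nonneg (hnn _ _)]
        exact (hker y c c (hnear _ hy) hcc hcc).2.1)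
    (by filter_upwards [haeQ] with y hy
        rw [abs_of_nonneg (hnn _ _)]
        exact (hker c y c hcc (hnear _ hy) hcc).2.1)
    (by filter_upwards [haeQQ] with z hz
        exact (hker z.1 z.2 c (hnear _ hz.1) (hnear _ hz.2) hcc).2.2)
    (by filter_upwards [haeQQ] with z hz
        rw [add_comm (‖x - z.1‖ ^ 2), add_comm (‖x - c‖ ^ 2)]
        exact (hker z.2 z.1 c (hnear _ hz.2) (hnear _ hz.1) hcc).2.2)
  have hexp : α / 2 - n = -κ := by rw [hκ]; ring
  have h2κ : 2 * κ = 2 * n - α := by rw [hκ]; ring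
  rw [hV, h2κ] at hA hT hTd
  rw [commI_testFn_eq hQm, hexp, hVol]
  set J := ∫ y₁ in Q, ∫ y₂ in Q, ((b x - avg n b Q) - (b y₁ - avg n b Q)) *
        ((b x - avg n b Q) - (b y₂ - avg n b Q)) * signFn n b Q y₁ * signFn n b Q y₂ *
        (‖x - y₁‖ ^ 2 + ‖x - y₂‖ ^ 2) ^ (-κ)
  have hscale := scaling_identity hn hq hr hρ0
  set P := (r ^ n) ^ (-(1 / p₁)) * (r ^ n) ^ (-(1 / p₂)) with hP
  have hP0 : 0 < P := by positivity
  set G := 1 + |b x - avg n b Q|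
  have hXm : ∀ t : ℝ, t ^ (-(2 * n - α) - 1) * t = t ^ (-(2 * n - α)) ∨ t ≤ 0 := by
    intro t
    rcases le_or_gt t 0 with h | h
    · exact Or.inr h
    · left
      nth_rewrite 2 [← Real.rpow_one t]
      rw [← Real.rpow_add h]; congr 1; ring
  have hX1 := (hXm (ρ * r)).resolve_right (not_le.2 hX0)
  have hρ1 := (hXm ρ).resolve_right (not_le.2 hρ0)
  refine ⟨?_, P * T, ?_, ?_⟩
  · rw [← hscale, abs_mul, abs_of_pos hP0]
    calc P * |J| ≤ P * (4 * (ρ * r) ^ (-(2 * n - α)) * (r ^ n * G) ^ 2) := by gcongr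
      _ = _ := by ring
  · rw [← hscale]
    calc _ = P * (4 ^ (-κ) * (ρ * r) ^ (-(2 * n - α)) * (r ^ n * e) ^ 2) := by ring
      _ ≤ _ := by gcongr
  · rw [← mul_sub, abs_mul, abs_of_pos hP0]
    have hs' : P * (r ^ n) ^ 2 * (r * (ρ * r) ^ (-(2 * n - α) - 1)) =
        (r ^ n) ^ (-(1 / q)) * ρ ^ (-(2 * n - α) - 1) := by
      have : ρ * (P * (r ^ n) ^ 2 * (r * (ρ * r) ^ (-(2 * n - α) - 1))) =
          ρ * ((r ^ n) ^ (-(1 / q)) * ρ ^ (-(2 * n - α) - 1)) := by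
        calc _ = P * (r ^ n) ^ 2 * ((ρ * r) ^ (-(2 * n - α) - 1) * (ρ * r)) := by ring
          _ = _ := by rw [hX1, hscale, ← hρ1]; ring
      exact mul_left_cancel₀ hρ0.ne' this
    calc P * |J - T| ≤ P * (4 * (8 * κ * (√n * r / 2) * (ρ * r) ^ (-(2 * n - α) - 1)) *
          (r ^ n * G) ^ 2) := by gcongr
      _ = 16 * √n * κ * G ^ 2 * (P * (r ^ n) ^ 2 * (r * (ρ * r) ^ (-(2 * n - α) - 1))) := by ring
      _ = _ := by rw [hs']

end Pointwise

section Annuli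

open Metric

/-- Decay of the weighted tail integrals of powers of a function in the unit ball of `BMO`. -/
theorem exists_setIntegral_osc_tail_le (n : ℕ) (hn : 1 ≤ n) (N : ℕ) {η θ : ℝ} (hη : 0 < η)
    (hθ : 0 ≤ θ) :
    ∃ C : ℝ, 0 < C ∧ ∀ b : Rn n → ℝ, LocallyIntegrable b volume →
      (∀ c r, 0 < r → osc n b (cube n c r) ≤ 1) → ∀ c r, 0 < r → ∀ γ : ℝ, 1 ≤ γ →
      ∀ S : Set (Rn n), MeasurableSet S → (∀ x ∈ S, γ ≤ ‖x - c‖ / r) →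
      IntegrableOn (fun x => (1 + |b x - avg n b (cube n c r)|) ^ N *
        (‖x - c‖ / r) ^ (-(n + η + θ))) S ∧
      ∫ x in S, (1 + |b x - avg n b (cube n c r)|) ^ N * (‖x - c‖ / r) ^ (-(n + η + θ)) ≤
        C * γ ^ (-θ) * r ^ n := by
  obtain ⟨C, hC0, hC⟩ := exists_integral_weighted_osc_cube_le n hn N hη
  refine ⟨2 ^ (n + η) * C, by positivity, fun b hb hosc c r hr γ hγ S hS hSγ => ?_⟩
  obtain ⟨hint, hle⟩ := hC b hb hosc c r hr
  set a := avg n b (cube n c r)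
  have hpt : ∀ x ∈ S, (1 + |b x - a|) ^ N * (‖x - c‖ / r) ^ (-(n + η + θ)) ≤
      2 ^ (n + η) * γ ^ (-θ) * ((1 + |b x - a|) ^ N * (1 + ‖x - c‖ / r) ^ (-(n + η))) := by
    intro x hx
    have hx' := hSγ x hx
    set ρ := ‖x - c‖ / r
    have hρ0 : 0 < ρ := by linarith
    have h1 : ρ ^ (-θ) ≤ γ ^ (-θ) :=
      Real.rpow_le_rpow_of_nonpos (by linarith) hx' (by linarith)
    have h2 : ρ ^ (-(n + η)) ≤ 2 ^ (n + η) * (1 + ρ) ^ (-(n + η)) := by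
      have h3 : ((1 + ρ) / 2) ^ (-(n + η)) = 2 ^ (n + η) * (1 + ρ) ^ (-(n + η)) := by
        rw [Real.div_rpow (by positivity) (by norm_num), Real.rpow_neg (x := 2) (by norm_num)]
        field_simp
      rw [← h3]
      refine Real.rpow_le_rpow_of_nonpos (by positivity) (by linarith) ?_
      have : (0 : ℝ) ≤ n := Nat.cast_nonneg n
      linarith
    calc _ = (1 + |b x - a|) ^ N * (ρ ^ (-(n + η)) * ρ ^ (-θ)) := by
          rw [← Real.rpow_add hρ0]; congr 2; ring
      _ ≤ (1 + |b x - a|) ^ N * ((2 ^ (n + η) * (1 + ρ) ^ (-(n + η))) * γ ^ (-θ)) := by gcongr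
      _ = _ := by ring
  have hint' := (hint.const_mul (2 ^ (n + η) * γ ^ (-θ)))
  have hmeas : AEStronglyMeasurable (fun x => (1 + |b x - a|) ^ N *
      (‖x - c‖ / r) ^ (-(n + η + θ))) volume := by
    have h1 : AEMeasurable b volume := hb.aestronglyMeasurable.aemeasurable
    have h2 : Measurable fun x : Rn n => (‖x - c‖ / r) ^ (-(n + η + θ)) := by fun_prop
    exact ((((h1.sub_const a).abs.const_add 1).pow_const N).mul
      h2.aemeasurable).aestronglyMeasurable
  have hI : IntegrableOn (fun x => (1 + |b x - a|) ^ N * (‖x - c‖ / r) ^ (-(n + η + θ))) S := by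
    refine hint'.integrableOn.mono' hmeas.restrict ?_
    filter_upwards [ae_restrict_mem hS] with x hx
    rw [Real.norm_of_nonneg (by positivity)]
    exact hpt x hx
  refine ⟨hI, ?_⟩
  calc _ ≤ ∫ x in S, 2 ^ (n + η) * γ ^ (-θ) *
        ((1 + |b x - a|) ^ N * (1 + ‖x - c‖ / r) ^ (-(n + η))) :=
        setIntegral_mono_on hI hint'.integrableOn hS hpt
    _ ≤ ∫ x, 2 ^ (n + η) * γ ^ (-θ) *
        ((1 + |b x - a|) ^ N * (1 + ‖x - c‖ / r) ^ (-(n + η))) :=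
        setIntegral_le_integral hint' (ae_of_all _ fun x => by positivity)
    _ ≤ 2 ^ (n + η) * γ ^ (-θ) * (C * r ^ n) := by
        rw [integral_const_mul]; gcongr
    _ = _ := by ring

theorem le_measureReal_annulus (n : ℕ) (hn : 1 ≤ n) (c : Rn n) {R : ℝ} (hR : 0 < R) :
    R ^ n * volume.real (closedBall (0 : Rn n) 1) ≤
      volume.real {x : Rn n | R < ‖x - c‖ ∧ ‖x - c‖ < 2 * R} := by
  have hset : {x : Rn n | R < ‖x - c‖ ∧ ‖x - c‖ < 2 * R} = ball c (2 * R) \ closedBall c R := by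
    ext x
    simp only [Set.mem_ofPred_eq, Set.mem_sdiff, mem_ball, mem_closedBall, dist_eq_norm, not_le]
    exact and_comm
  have : Nontrivial (Rn n) := by
    have : Nonempty (Fin n) := ⟨⟨0, hn⟩⟩
    infer_instance
  rw [hset, measureReal_sdiff (closedBall_subset_ball (by linarith)) measurableSet_closedBall,
    ← Measure.addHaar_real_closedBall_eq_addHaar_real_ball, measureReal_closedBall_Rn n c hR.le,
    measureReal_closedBall_Rn n c (by positivity), ← sub_mul]
  have h2 : (2 : ℝ) ≤ 2 ^ n := by
    calc (2 : ℝ) = 2 ^ 1 := by norm_num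
      _ ≤ _ := by gcongr; norm_num
  have hω : 0 ≤ volume.real (closedBall (0 : Rn n) 1) := measureReal_nonneg
  gcongr
  rw [mul_pow]
  nlinarith [pow_pos hR n]

/-- Lower and upper bounds on annuli for a function which is comparable to a negative power of the
distance to the center, up to powers of a function in the unit ball of `BMO`. -/
theorem exists_annulus_bounds (n : ℕ) (hn : 1 ≤ n) (N : ℕ) {τ q L M M' K R : ℝ} (hτ : 0 < τ)
    (hq : 0 < q) (hL : 0 < L) (hM : 0 < M) (hM' : 0 < M') (hK : 0 < K) :
    ∃ γ₁ γ₂ δ β : ℝ, 2 < γ₁ ∧ γ₁ < γ₂ ∧ 0 < δ ∧ 0 < β ∧ β < γ₂ ∧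
      ∀ b : Rn n → ℝ, LocallyIntegrable b volume →
      (∀ c r, 0 < r → osc n b (cube n c r) ≤ 1) → ∀ c r, 0 < r →
      ∀ H : Rn n → ℝ, AEStronglyMeasurable H volume → (∀ x, 0 ≤ H x) →
      (∀ x, R ≤ ‖x - c‖ / r → H x ≤ M * (r ^ n)⁻¹ *
        ((1 + |b x - avg n b (cube n c r)|) ^ N * (‖x - c‖ / r) ^ (-(n + τ)))) →
      (∀ x, R ≤ ‖x - c‖ / r → L * (r ^ n)⁻¹ * (‖x - c‖ / r) ^ (-(n + τ)) ≤
        H x + M' * (r ^ n)⁻¹ *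
          ((1 + |b x - avg n b (cube n c r)|) ^ N * (‖x - c‖ / r) ^ (-(n + τ + q)))) →
      δ ≤ ∫ x in {x : Rn n | γ₁ * r < ‖x - c‖ ∧ ‖x - c‖ < γ₂ * r}, H x ∧
      ∫ x in {x : Rn n | γ₂ * r < ‖x - c‖}, H x ≤ δ / K ∧
      ∀ E : Set (Rn n), MeasurableSet E →
        E ⊆ {x : Rn n | γ₁ * r < ‖x - c‖ ∧ ‖x - c‖ < γ₂ * r} →
        (volume E).toReal < β ^ n * (volume (cube n c r)).toReal →
        ∫ x in E, H x ≤ δ / K := by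
  set ω := volume.real (closedBall (0 : Rn n) 1) with hωdef
  have hω : 0 < ω := measureReal_closedBall_pos (volume : Measure (Rn n)) 0 one_pos
  obtain ⟨C₁, hC₁0, hC₁⟩ := exists_setIntegral_osc_tail_le n hn N (half_pos hq)
    (show 0 ≤ τ + q / 2 by positivity)
  obtain ⟨C₂, hC₂0, hC₂⟩ := exists_setIntegral_osc_tail_le n hn N (half_pos hτ) (half_pos hτ).le
  obtain ⟨C₃, hC₃0, hC₃⟩ := exists_setIntegral_osc_tail_le n hn (2 * N) hτ le_rfl
  have e₁ : (n + q / 2 + (τ + q / 2) : ℝ) = n + τ + q := by ring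
  have e₂ : (n + τ / 2 + τ / 2 : ℝ) = n + τ := by ring
  have e₃ : (n + τ + 0 : ℝ) = n + τ := by ring
  rw [e₁] at hC₁
  rw [e₂] at hC₂
  simp only [e₃, neg_zero, Real.rpow_zero, mul_one] at hC₃
  set D : ℝ := L * ω * 2 ^ (-(n + τ)) with hD
  have hD0 : 0 < D := by positivity
  obtain ⟨γ₁, hγ₁, hγ₁R, hγ₁2⟩ : ∃ γ₁ : ℝ, M' * C₁ * γ₁ ^ (-(q / 2)) ≤ D / 2 ∧ R ≤ γ₁ ∧ 2 < γ₁ := by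
    have ht : Tendsto (fun γ : ℝ => M' * C₁ * γ ^ (-(q / 2))) atTop (𝓝 (M' * C₁ * 0)) :=
      (tendsto_rpow_neg_atTop (half_pos hq)).const_mul _
    rw [mul_zero] at ht
    exact ((ht.eventually_le_const (half_pos hD0)).and
      ((eventually_ge_atTop R).and (eventually_gt_atTop 2))).exists
  have hγ₁0 : 0 < γ₁ := by linarith
  set δ : ℝ := D / 2 * γ₁ ^ (-τ) with hδ
  have hδ0 : 0 < δ := by positivity
  obtain ⟨γ₂, hγ₂, hγ₂1⟩ : ∃ γ₂ : ℝ, M * C₂ * γ₂ ^ (-(τ / 2)) ≤ δ / K ∧ 2 * γ₁ ≤ γ₂ := by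
    have ht : Tendsto (fun γ : ℝ => M * C₂ * γ ^ (-(τ / 2))) atTop (𝓝 (M * C₂ * 0)) :=
      (tendsto_rpow_neg_atTop (half_pos hτ)).const_mul _
    rw [mul_zero] at ht
    exact ((ht.eventually_le_const (div_pos hδ0 hK)).and (eventually_ge_atTop (2 * γ₁))).exists
  set l : ℝ := 2 * K * M * C₃ / δ with hl
  have hl0 : 0 < l := by positivity
  set β : ℝ := min 1 (δ / (2 * K * M * l)) with hβ
  have hβ0 : 0 < β := lt_min one_pos (by positivity)
  have hβ1 : β ≤ 1 := min_le_left _ _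
  refine ⟨γ₁, γ₂, δ, β, hγ₁2, by linarith, hδ0, hβ0, by linarith, ?_⟩
  intro b hb hosc c r hr H hHm hH0 hA hB
  set G : Rn n → ℝ := fun x => 1 + |b x - avg n b (cube n c r)| with hG
  set ρ : Rn n → ℝ := fun x => ‖x - c‖ / r with hρ
  have hrn : 0 < r ^ n := by positivity
  have hG1 : ∀ x, 1 ≤ G x := fun x => by simp [hG]
  have hgt : ∀ (γ : ℝ) (x : Rn n), γ * r < ‖x - c‖ ↔ γ < ρ x := fun γ x => (lt_div_iff₀ hr).symm
  have hlt : ∀ (γ : ℝ) (x : Rn n), ‖x - c‖ < γ * r ↔ ρ x < γ := fun γ x => (div_lt_iff₀ hr).symm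
  have hmgt : ∀ γ : ℝ, MeasurableSet {x : Rn n | γ * r < ‖x - c‖} := fun γ =>
    measurableSet_lt measurable_const (measurable_id.sub_const c).norm
  have hman : ∀ γ γ' : ℝ, MeasurableSet {x : Rn n | γ * r < ‖x - c‖ ∧ ‖x - c‖ < γ' * r} :=
    fun γ γ' => (hmgt γ).inter (measurableSet_lt (measurable_id.sub_const c).norm measurable_const)
  have hHint : ∀ γ : ℝ, γ₁ ≤ γ → IntegrableOn H {x : Rn n | γ * r < ‖x - c‖} ∧
      ∫ x in {x : Rn n | γ * r < ‖x - c‖}, H x ≤ M * C₂ * γ ^ (-(τ / 2)) := by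
    intro γ hγ
    have hS : ∀ x ∈ {x : Rn n | γ * r < ‖x - c‖}, γ ≤ ‖x - c‖ / r := fun x hx =>
      ((hgt γ x).1 hx).le
    obtain ⟨hI, hle⟩ := hC₂ b hb hosc c r hr γ (by linarith) _ (hmgt γ) hS
    have hI' := hI.const_mul (M * (r ^ n)⁻¹)
    have hpt : ∀ x ∈ {x : Rn n | γ * r < ‖x - c‖}, H x ≤ M * (r ^ n)⁻¹ *
        (G x ^ N * ρ x ^ (-(n + τ))) := fun x hx =>
      hA x (hγ₁R.trans (hγ.trans (hS x hx)))
    have hHI : IntegrableOn H {x : Rn n | γ * r < ‖x - c‖} := by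
      refine hI'.mono' hHm.restrict ?_
      filter_upwards [ae_restrict_mem (hmgt γ)] with x hx
      rw [Real.norm_of_nonneg (hH0 x)]
      exact hpt x hx
    refine ⟨hHI, (setIntegral_mono_on hHI hI' (hmgt γ) hpt).trans ?_⟩
    rw [integral_const_mul]
    calc _ ≤ M * (r ^ n)⁻¹ * (C₂ * γ ^ (-(τ / 2)) * r ^ n) := by gcongr
      _ = _ := by field_simp
  have hsub : ∀ γ γ' : ℝ, {x : Rn n | γ * r < ‖x - c‖ ∧ ‖x - c‖ < γ' * r} ⊆
      {x : Rn n | γ * r < ‖x - c‖} := fun γ γ' x hx => hx.1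
  refine ⟨?_, (hHint γ₂ (by linarith)).2.trans hγ₂, ?_⟩
  · set S : Set (Rn n) := {x : Rn n | γ₁ * r < ‖x - c‖ ∧ ‖x - c‖ < 2 * (γ₁ * r)} with hS
    have hSm : MeasurableSet S := by
      have := hman γ₁ (2 * γ₁)
      rwa [mul_assoc] at this
    have hSρ : ∀ x ∈ S, γ₁ ≤ ‖x - c‖ / r := fun x hx => ((hgt γ₁ x).1 hx.1).le
    have hSρ' : ∀ x ∈ S, ρ x ≤ 2 * γ₁ := fun x hx => by
      have := hx.2
      rw [← mul_assoc] at this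
      exact ((hlt _ x).1 this).le
    have hSvol := le_measureReal_annulus n hn c (R := γ₁ * r) (by positivity)
    have hSfin : volume S ≠ ∞ := by
      refine ((measure_mono fun x hx => ?_).trans_lt
        (measure_ball_lt_top (μ := volume) (x := c) (r := 2 * (γ₁ * r)))).ne
      rw [mem_ball, dist_eq_norm]
      exact hx.2
    obtain ⟨hI, hle⟩ := hC₁ b hb hosc c r hr γ₁ (by linarith) S hSm hSρ
    have hI' := hI.const_mul (M' * (r ^ n)⁻¹)
    have hHS : IntegrableOn H S := (hHint γ₁ le_rfl).1.mono_set fun x hx => hx.1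
    have hlow : ∫ _x in S, L * (r ^ n)⁻¹ * (2 * γ₁) ^ (-(n + τ)) ≤
        ∫ x in S, (H x + M' * (r ^ n)⁻¹ * (G x ^ N * ρ x ^ (-(n + τ + q)))) := by
      refine setIntegral_mono_on (integrableOn_const hSfin) (hHS.add hI') hSm fun x hx => ?_
      refine le_trans ?_ (hB x (hγ₁R.trans (hSρ x hx)))
      gcongr ?_ * ?_
      refine Real.rpow_le_rpow_of_nonpos (hγ₁0.trans_le (hSρ x hx)) (hSρ' x hx) ?_
      have : (0 : ℝ) ≤ n := Nat.cast_nonneg n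
      linarith
    rw [integral_add hHS hI', setIntegral_const, smul_eq_mul, integral_const_mul] at hlow
    have hlow' : D * γ₁ ^ (-τ) ≤
        volume.real S * (L * (r ^ n)⁻¹ * (2 * γ₁) ^ (-(n + τ))) := by
      calc D * γ₁ ^ (-τ) = (γ₁ * r) ^ n * ω * (L * (r ^ n)⁻¹ * (2 * γ₁) ^ (-(n + τ))) := by
            have : γ₁ ^ (-τ) = γ₁ ^ n * γ₁ ^ (-(n + τ)) := by
              rw [← Real.rpow_natCast, ← Real.rpow_add hγ₁0]; congr 1; ring
            rw [hD, Real.mul_rpow (by norm_num) hγ₁0.le, mul_pow, this]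
            field_simp
        _ ≤ _ := by gcongr
    have herr : M' * (r ^ n)⁻¹ * ∫ x in S, G x ^ N * ρ x ^ (-(n + τ + q)) ≤
        D / 2 * γ₁ ^ (-τ) := by
      calc _ ≤ M' * (r ^ n)⁻¹ * (C₁ * γ₁ ^ (-(τ + q / 2)) * r ^ n) := by gcongr
        _ = (M' * C₁ * γ₁ ^ (-(q / 2))) * γ₁ ^ (-τ) := by
            rw [neg_add_rev, Real.rpow_add hγ₁0]; field_simp
        _ ≤ _ := by gcongr
    have hmono : ∫ x in S, H x ≤
        ∫ x in {x : Rn n | γ₁ * r < ‖x - c‖ ∧ ‖x - c‖ < γ₂ * r}, H x := by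
      have hSsub : S ⊆ {x : Rn n | γ₁ * r < ‖x - c‖ ∧ ‖x - c‖ < γ₂ * r} := fun x hx =>
        ⟨hx.1, hx.2.trans_le (by rw [← mul_assoc]; gcongr)⟩
      exact setIntegral_mono_set ((hHint γ₁ le_rfl).1.mono_set (hsub _ _))
        (ae_of_all _ hH0) hSsub.eventuallyLE
    rw [hδ]
    linarith
  · intro E hE hEs hEvol
    have hEρ : ∀ x ∈ E, γ₁ ≤ ‖x - c‖ / r := fun x hx => ((hgt γ₁ x).1 (hEs hx).1).le
    have hEfin : volume E ≠ ∞ := by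
      refine ((measure_mono fun x hx => ?_).trans_lt
        (measure_ball_lt_top (μ := volume) (x := c) (r := γ₂ * r))).ne
      rw [mem_ball, dist_eq_norm]
      exact (hEs hx).2
    obtain ⟨hI, hle⟩ := hC₃ b hb hosc c r hr 1 le_rfl E hE fun x hx => by
      have := hEρ x hx
      linarith
    have hI' : IntegrableOn (fun x => M * (r ^ n)⁻¹ * l + M * (r ^ n)⁻¹ * l⁻¹ *
        (G x ^ (2 * N) * ρ x ^ (-(n + τ)))) E :=
      (integrableOn_const hEfin).add (hI.const_mul _)
    have hpt : ∀ x ∈ E, H x ≤ M * (r ^ n)⁻¹ * l + M * (r ^ n)⁻¹ * l⁻¹ *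
        (G x ^ (2 * N) * ρ x ^ (-(n + τ))) := by
      intro x hx
      refine (hA x (hγ₁R.trans (hEρ x hx))).trans ?_
      have h1 : ρ x ^ (-(n + τ)) ≤ 1 := by
        refine Real.rpow_le_one_of_one_le_of_nonpos (by have := hEρ x hx; simp only [hρ]; linarith) ?_
        have : (0 : ℝ) ≤ n := Nat.cast_nonneg n
        linarith
      have h0 : 0 ≤ ρ x ^ (-(n + τ)) := by positivity
      have h2 : G x ^ N ≤ l + l⁻¹ * G x ^ (2 * N) := by
        have h3 : 0 ≤ l⁻¹ * ((l - G x ^ N) ^ 2 + l * G x ^ N) := by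
          have := hG1 x
          positivity
        have h4 : l⁻¹ * ((l - G x ^ N) ^ 2 + l * G x ^ N) =
            l + l⁻¹ * G x ^ (2 * N) - G x ^ N := by
          rw [pow_mul']
          field_simp
          ring
        linarith
      calc _ ≤ M * (r ^ n)⁻¹ * ((l + l⁻¹ * G x ^ (2 * N)) * ρ x ^ (-(n + τ))) := by gcongr
        _ = M * (r ^ n)⁻¹ * l * ρ x ^ (-(n + τ)) + M * (r ^ n)⁻¹ * l⁻¹ *
              (G x ^ (2 * N) * ρ x ^ (-(n + τ))) := by ring
        _ ≤ _ := by
            exact add_le_add_left (mul_le_of_le_one_right (by positivity) h1) _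
    have hHE : IntegrableOn H E := (hHint γ₁ le_rfl).1.mono_set fun x hx => (hEs hx).1
    refine (setIntegral_mono_on hHE hI' hE hpt).trans ?_
    rw [integral_add (integrableOn_const (C := M * (r ^ n)⁻¹ * l) hEfin) (hI.const_mul _),
      setIntegral_const, smul_eq_mul, measureReal_def, integral_const_mul]
    rw [volume_cube_toReal n c hr.le] at hEvol
    have hβn : β ^ n ≤ δ / (2 * K * M * l) :=
      (pow_le_of_le_one hβ0.le hβ1 (by omega)).trans (min_le_right _ _)
    calc _ ≤ (β ^ n * r ^ n) * (M * (r ^ n)⁻¹ * l) + M * (r ^ n)⁻¹ * l⁻¹ * (C₃ * r ^ n) := by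
          gcongr
      _ = β ^ n * (M * l) + M * l⁻¹ * C₃ := by field_simp
      _ ≤ δ / (2 * K * M * l) * (M * l) + M * l⁻¹ * C₃ := by gcongr
      _ = δ / K := by
          rw [hl]; field_simp; ring

end Annuli

theorem rpow_le_two_rpow_mul_add {a u v q : ℝ} (hq : 0 ≤ q) (ha : 0 ≤ a) (hu : 0 ≤ u) (hv : 0 ≤ v)
    (h : a ≤ u + v) : a ^ q ≤ 2 ^ q * (u ^ q + v ^ q) := by
  have hm : a ≤ 2 * max u v := by
    have := le_max_left u v
    have := le_max_right u v
    linarith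
  calc a ^ q ≤ (2 * max u v) ^ q := Real.rpow_le_rpow ha hm hq
    _ = 2 ^ q * max u v ^ q := Real.mul_rpow (by norm_num) (le_max_of_le_left hu)
    _ ≤ _ := by
        gcongr
        have := Real.rpow_nonneg hu q
        have := Real.rpow_nonneg hv q
        rcases max_choice u v with h | h <;> rw [h] <;> linarith

/-- Lemma 3: lower and upper bounds for `[Πb⃗, I_α](f₁, f₂)` on annuli, for
the special mean-zero test functions `f₁`, `f₂` built from a cube `Q` on which `b`
oscillates. -/
theorem statement9 (n : ℕ) (hn : 1 ≤ n) (α p₁ p₂ q : ℝ)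
    (hα : 0 < α) (hαn : α < 2 * n)
    (hp₁ : 1 < p₁) (hp₂ : 1 < p₂) (hq1 : 1 < q)
    (hαp : α / n < 1 / p₁ + 1 / p₂)
    (hq : 1 / q = 1 / p₁ + 1 / p₂ - α / n)
    (ε : ℝ) (hε0 : 0 < ε) (hε1 : ε < 1) :
    ∃ γ₁ γ₂ γ₃ β : ℝ, 2 < γ₁ ∧ γ₁ < γ₂ ∧ 0 < γ₃ ∧ 0 < β ∧ β < γ₂ ∧
      ∀ (b : Rn n → ℝ) (c : Rn n) (r : ℝ), 0 < r →
        LocallyIntegrable b volume → bmoNorm n b = 1 →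
        (¬ ∃ k : ℝ, ∀ᵐ y ∂volume.restrict (cube n c r), b y = k) →
        Real.sqrt ε < osc n b (cube n c r) →
        (γ₃ ^ q ≤
            ∫ x in {x : Rn n | γ₁ * r < ‖x - c‖ ∧ ‖x - c‖ < γ₂ * r},
              |commI n α b
                  ((cube n c r).indicator fun y =>
                    (volume (cube n c r)).toReal ^ (-(1 / p₁)) *
                      (Real.sign (b y - avg n b (cube n c r)) -
                        (volume (cube n c r)).toReal⁻¹ *
                          ∫ z in cube n c r, Real.sign (b z - avg n b (cube n c r))))
                  ((cube n c r).indicator fun y =>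
                    (volume (cube n c r)).toReal ^ (-(1 / p₂)) *
                      (Real.sign (b y - avg n b (cube n c r)) -
                        (volume (cube n c r)).toReal⁻¹ *
                          ∫ z in cube n c r, Real.sign (b z - avg n b (cube n c r))))
                  x| ^ q) ∧
        (∫ x in {x : Rn n | γ₂ * r < ‖x - c‖},
              |commI n α b
                  ((cube n c r).indicator fun y =>
                    (volume (cube n c r)).toReal ^ (-(1 / p₁)) *
                      (Real.sign (b y - avg n b (cube n c r)) -
                        (volume (cube n c r)).toReal⁻¹ *
                          ∫ z in cube n c r, Real.sign (b z - avg n b (cube n c r))))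
                  ((cube n c r).indicator fun y =>
                    (volume (cube n c r)).toReal ^ (-(1 / p₂)) *
                      (Real.sign (b y - avg n b (cube n c r)) -
                        (volume (cube n c r)).toReal⁻¹ *
                          ∫ z in cube n c r, Real.sign (b z - avg n b (cube n c r))))
                  x| ^ q ≤ γ₃ ^ q / 4 ^ q) ∧
        (∀ E : Set (Rn n), MeasurableSet E →
          E ⊆ {x : Rn n | γ₁ * r < ‖x - c‖ ∧ ‖x - c‖ < γ₂ * r} →
          (volume E).toReal < β ^ n * (volume (cube n c r)).toReal →
          ∫ x in E,
              |commI n α b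
                  ((cube n c r).indicator fun y =>
                    (volume (cube n c r)).toReal ^ (-(1 / p₁)) *
                      (Real.sign (b y - avg n b (cube n c r)) -
                        (volume (cube n c r)).toReal⁻¹ *
                          ∫ z in cube n c r, Real.sign (b z - avg n b (cube n c r))))
                  ((cube n c r).indicator fun y =>
                    (volume (cube n c r)).toReal ^ (-(1 / p₂)) *
                      (Real.sign (b y - avg n b (cube n c r)) -
                        (volume (cube n c r)).toReal⁻¹ *
                          ∫ z in cube n c r, Real.sign (b z - avg n b (cube n c r))))
                  x| ^ q ≤ γ₃ ^ q / 4 ^ q) := by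
  have hn0 : (0 : ℝ) < n := by exact_mod_cast hn
  have hq0 : 0 < q := by linarith
  set d : ℝ := 2 * n - α with hd
  set κ : ℝ := n - α / 2 with hκ
  have hκ0 : 0 < κ := by rw [hκ]; linarith
  set τ : ℝ := d * q - n with hτ
  have hdq : d * q = n + τ := by rw [hτ]; ring
  have hτ0 : 0 < τ := by
    have h1 : 1 / p₁ < 1 := (div_lt_one (by linarith)).2 hp₁
    have h2 : 1 / p₂ < 1 := (div_lt_one (by linarith)).2 hp₂
    have h3 : τ = n * q * (2 - 1 / p₁ - 1 / p₂) := by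
      have h4 : n * q * (1 / q) = n * q * (1 / p₁ + 1 / p₂ - α / n) := by rw [hq]
      have h5 : n * q * (1 / q) = (n : ℝ) := by field_simp
      have h6 : n * q * (α / n) = α * q := by field_simp
      rw [hτ, hd]
      linear_combination h5 - h4 + h6
    rw [h3]
    have : 0 < 2 - 1 / p₁ - 1 / p₂ := by linarith
    positivity
  obtain ⟨N, hN⟩ := exists_nat_ge (2 * q)
  obtain ⟨γ₁, γ₂, δ, β, hγ₁, hγ₂, hδ, hβ, hβγ, hmain⟩ :=
    exists_annulus_bounds n hn N (τ := τ) (q := q)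
      (L := (2 ^ q)⁻¹ * ((4 ^ (-κ)) ^ q * ε ^ q)) (M := 4 ^ q)
      (M' := (16 * √n * κ) ^ q) (K := 4 ^ q) (R := max 1 (2 * √n))
      hτ0 hq0 (by positivity) (by positivity) (by positivity) (by positivity)
  have hδq : (δ ^ (1 / q)) ^ q = δ := by
    rw [← Real.rpow_mul hδ.le, one_div_mul_cancel hq0.ne', Real.rpow_one]
  refine ⟨γ₁, γ₂, δ ^ (1 / q), β, hγ₁, hγ₂, by positivity, hβ, hβγ, ?_⟩
  intro b c r hr hb hbmo _ hosc
  have hosc1 : ∀ c r, 0 < r → osc n b (cube n c r) ≤ 1 := fun c r hr =>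
    osc_le_one_of_bmoNorm_eq_one hbmo c hr
  have hQm := measurableSet_cube n c r
  rw [hδq]
  set F := commI n α b (testFn n b (cube n c r) p₁) (testFn n b (cube n c r) p₂) with hF
  set G : Rn n → ℝ := fun x => 1 + |b x - avg n b (cube n c r)| with hG
  have hG1 : ∀ x, 1 ≤ G x := fun x => by simp [hG]
  have hGq : ∀ x, (G x ^ 2) ^ q ≤ G x ^ N := fun x => by
    have hGx : 0 ≤ G x := zero_le_one.trans (hG1 x)
    rw [← Real.rpow_natCast (G x) 2, ← Real.rpow_mul hGx, ← Real.rpow_natCast (G x) N]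
    exact Real.rpow_le_rpow_of_exponent_le (hG1 x) (by push_cast; exact hN)
  have hrn : 0 < r ^ n := by positivity
  have hu : ((r ^ n) ^ (-(1 / q))) ^ q = (r ^ n)⁻¹ := by
    rw [← Real.rpow_mul hrn.le, neg_mul, one_div_mul_cancel hq0.ne', Real.rpow_neg_one]
  set u := (r ^ n) ^ (-(1 / q)) with hu_def
  have hu0 : 0 < u := by positivity
  have hscale : ∀ A t ρ σ : ℝ, 0 ≤ A → 0 ≤ t → 0 ≤ ρ →
      (A * t * (u * ρ ^ (-σ))) ^ q = A ^ q * (r ^ n)⁻¹ * (t ^ q * ρ ^ (-(σ * q))) := by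
    intro A t ρ σ hA ht hρ
    rw [Real.mul_rpow (by positivity) (by positivity), Real.mul_rpow hA ht,
      Real.mul_rpow hu0.le (by positivity), hu, ← Real.rpow_mul hρ]
    ring_nf
  have hFm : AEStronglyMeasurable (fun x => |F x| ^ q) volume :=
    ((aestronglyMeasurable_commI hb.aestronglyMeasurable
      (aestronglyMeasurable_testFn hb hQm p₁)
      (aestronglyMeasurable_testFn hb hQm p₂)).aemeasurable.abs.pow_const q).aestronglyMeasurable
  have hbd := fun (x : Rn n) (hx : max 1 (2 * √n) ≤ ‖x - c‖ / r) =>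
    commI_testFn_bounds hn (p₁ := p₁) (p₂ := p₂) hαn hq hb hr (hosc1 c r hr)
      (Real.sqrt_nonneg ε) hosc.le ((le_max_right _ _).trans hx)
  have hρ0 : ∀ x : Rn n, 0 ≤ ‖x - c‖ / r := fun x => by positivity
  refine hmain b hb hosc1 c r hr (fun x => |F x| ^ q) hFm (fun x => by positivity)
    (fun x hx => ?_) fun x hx => ?_
  · obtain ⟨hA, -⟩ := hbd x hx
    have hGx := hG1 x
    calc |F x| ^ q ≤ (4 * G x ^ 2 * (u * (‖x - c‖ / r) ^ (-d))) ^ q :=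
          Real.rpow_le_rpow (abs_nonneg _) hA hq0.le
      _ = 4 ^ q * (r ^ n)⁻¹ * ((G x ^ 2) ^ q * (‖x - c‖ / r) ^ (-(n + τ))) := by
          rw [hscale _ _ _ _ (by norm_num) (by positivity) (hρ0 x), hdq]
      _ ≤ _ := by gcongr; exact hGq x
  · obtain ⟨-, T, hT, hTd⟩ := hbd x hx
    have hGx := hG1 x
    rw [Real.sq_sqrt hε0.le] at hT
    change 4 ^ (-κ) * ε * (u * (‖x - c‖ / r) ^ (-d)) ≤ T at hT
    change |F x - T| ≤ 16 * √n * κ * G x ^ 2 * (u * (‖x - c‖ / r) ^ (-d - 1)) at hTd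
    have hle : 4 ^ (-κ) * ε * (u * (‖x - c‖ / r) ^ (-d)) ≤
        |F x| + 16 * √n * κ * G x ^ 2 * (u * (‖x - c‖ / r) ^ (-(d + 1))) := by
      rw [neg_add', ← sub_le_iff_le_add']
      have h1 := (neg_le_abs (F x - T)).trans hTd
      have h2 := le_abs_self (F x)
      linarith
    have hpow := rpow_le_two_rpow_mul_add hq0.le (by positivity) (abs_nonneg _) (by positivity) hle
    rw [hscale _ _ _ _ (by positivity) hε0.le (hρ0 x),
      hscale _ _ _ _ (by positivity) (by positivity) (hρ0 x), add_mul, hdq, one_mul] at hpow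
    calc (2 ^ q)⁻¹ * ((4 ^ (-κ)) ^ q * ε ^ q) * (r ^ n)⁻¹ * (‖x - c‖ / r) ^ (-(n + τ))
        = (2 ^ q)⁻¹ * ((4 ^ (-κ)) ^ q * (r ^ n)⁻¹ * (ε ^ q * (‖x - c‖ / r) ^ (-(n + τ)))) := by ring
      _ ≤ (2 ^ q)⁻¹ * (2 ^ q * (|F x| ^ q + (16 * √n * κ) ^ q * (r ^ n)⁻¹ *
            ((G x ^ 2) ^ q * (‖x - c‖ / r) ^ (-(n + τ + q))))) := by gcongr
      _ = |F x| ^ q + (16 * √n * κ) ^ q * (r ^ n)⁻¹ *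
            ((G x ^ 2) ^ q * (‖x - c‖ / r) ^ (-(n + τ + q))) :=
          inv_mul_cancel_left₀ (by positivity) _
      _ ≤ _ := by gcongr; exact hGq x
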